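/- Let n ≥ 1 and let Q₁,…,Qₙ be pairwise distinct smooth conics in the complex projective plane ℙ² for which there exists a point p ∈ ℙ² such that for all i ≠ j the set-theoretic intersection Qᵢ ∩ Qⱼ equals the single point {p} (so any two of the conics are tangent to each other at p with contact of order four). Then the fundamental group π₁(ℙ² ∖ (Q₁ ∪ ⋯ ∪ Qₙ)) is isomorphic to the presented group ⟨a₁,…,aₙ | (a₁a₂⋯aₙ)² = e⟩, i.e. to the quotient of the free group on generators a₁,…,aₙ by the normal closure of the single word (a₁a₂⋯aₙ)². -/

import Mathlib

open MvPolynomial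

noncomputable section

/-- The complex projective plane, with the quotient topology. -/
instance : TopologicalSpace (Projectivization ℂ (Fin 3 → ℂ)) :=
  @instTopologicalSpaceQuotient _ (projectivizationSetoid ℂ (Fin 3 → ℂ)) _

abbrev P2 : Type := Projectivization ℂ (Fin 3 → ℂ)

/-- The gradient of a polynomial in three variables. -/
def gradP (P : MvPolynomial (Fin 3) ℂ) (v : Fin 3 → ℂ) : Fin 3 → ℂ :=
  fun i => eval v (pderiv i P)

/-- The zero locus in `ℙ²` of a (homogeneous) polynomial in three variables. -/
def zeroLocusP2 (P : MvPolynomial (Fin 3) ℂ) : Set P2 :=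
  {x | eval x.rep P = 0}

/-- A smooth conic: the zero locus of a homogeneous polynomial of degree 2 whose
gradient vanishes only at the origin. -/
def IsSmoothConic (Q : Set P2) : Prop :=
  ∃ P : MvPolynomial (Fin 3) ℂ, P.IsHomogeneous 2 ∧
    (∀ v : Fin 3 → ℂ, v ≠ 0 → gradP P v ≠ 0) ∧ Q = zeroLocusP2 P

/-- The single relator `(a₁ a₂ ⋯ aₙ)²`. -/
def relAn (n : ℕ) : Set (FreeGroup (Fin n)) :=
  {((List.ofFn fun i : Fin n => FreeGroup.of i).prod) ^ 2}

section

open Topology Set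

/-- The fibre bundle with discrete fibre `G` and transition functions `(c j)⁻¹ * c i`. -/
def cocycleBundle {X ι G : Type*} [TopologicalSpace X] [Group G] [TopologicalSpace G]
    [DiscreteTopology G] (U : ι → Set X) (hU : ∀ i, IsOpen (U i)) (idx : X → ι)
    (hidx : ∀ x, x ∈ U (idx x)) (c : ι → X → G)
    (hc : ∀ i j x, x ∈ U i → x ∈ U j →
      ∀ᶠ y in 𝓝 x, (c j y)⁻¹ * c i y = (c j x)⁻¹ * c i x) : FiberBundleCore ι X G where
  baseSet := U
  isOpen_baseSet := hU
  indexAt := idx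
  mem_baseSet_at := hidx
  coordChange i j x v := (c j x)⁻¹ * c i x * v
  coordChange_self i x _ v := by simp
  continuousOn_coordChange i j := by
    rintro ⟨x, v⟩ ⟨⟨hi, hj⟩, -⟩
    apply ContinuousAt.continuousWithinAt
    have h1 : ContinuousAt (fun p : X × G => (c j x)⁻¹ * c i x * p.2) (x, v) :=
      (continuous_of_discreteTopology.comp continuous_snd :
        Continuous ((fun g : G => (c j x)⁻¹ * c i x * g) ∘ Prod.snd)).continuousAt
    refine h1.congr ?_
    filter_upwards [continuousAt_fst.eventually (hc i j x hi hj)] with p hp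
    rw [hp]
  coordChange_comp i j k x _ v := by group

/-- A locally constant `G`-valued cocycle induces a parallel transport along homotopy classes of
paths. -/
theorem exists_transport {X ι G : Type*} [TopologicalSpace X] [Group G] (U : ι → Set X)
    (hU : ∀ i, IsOpen (U i)) (hcov : ∀ x, ∃ i, x ∈ U i) (c : ι → X → G)
    (hc : ∀ i j x, x ∈ U i → x ∈ U j →
      ∀ᶠ y in 𝓝 x, (c j y)⁻¹ * c i y = (c j x)⁻¹ * c i x) :
    ∃ M : ∀ x y : X, Path.Homotopic.Quotient x y → G → G,
      (∀ x g, M x x (.refl x) g = g) ∧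
      (∀ x y z (p : Path.Homotopic.Quotient x y) (q : Path.Homotopic.Quotient y z) g,
        M x z (p.trans q) g = M y z q (M x y p g)) ∧
      ∀ i x y (γ : Path x y), (∀ t, γ t ∈ U i) → ∀ g,
        M x y (.mk γ) g = c i y * (c i x)⁻¹ * g := by
  let _ : TopologicalSpace G := ⊥
  have : DiscreteTopology G := ⟨rfl⟩
  choose idx hidx using hcov
  let Z := cocycleBundle U hU idx hidx c hc
  have cov : IsCoveringMap (Bundle.TotalSpace.proj (F := G) (E := Z.Fiber)) :=
    FiberBundle.isCoveringMap
  let gl : Z.TotalSpace → G := fun e => c (idx e.1) e.1 * (show G from e.2)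
  let mkE : X → G → Z.TotalSpace := fun x g => ⟨x, (c (idx x) x)⁻¹ * g⟩
  have gl_mk : ∀ x g, gl (mkE x g) = g := fun x g => mul_inv_cancel_left _ _
  have mk_gl : ∀ e : Z.TotalSpace, mkE e.1 (gl e) = e := by
    rintro ⟨x, v⟩
    exact congrArg (Bundle.TotalSpace.mk x) (inv_mul_cancel_left (c (idx x) x) v)
  refine ⟨fun x y p g => gl (cov.monodromy p ⟨mkE x g, rfl⟩).1, ?_, ?_, ?_⟩
  · intro x g
    simp only [cov.monodromy_refl, id, gl_mk]
  · intro x y z p q g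
    simp only [cov.monodromy_trans_apply]
    refine congrArg (fun e => gl (cov.monodromy q e).1) (Subtype.ext ?_)
    generalize cov.monodromy p ⟨mkE x g, rfl⟩ = e
    obtain ⟨e, rfl⟩ := e
    exact (mk_gl e).symm
  · intro i x y γ hγ g
    have hcont : Continuous fun t => (Z.localTriv i).toOpenPartialHomeomorph.symm
        (γ t, (c i x)⁻¹ * g) := by
      refine (Z.localTriv i).toOpenPartialHomeomorph.continuousOn_symm.comp_continuous
        (by fun_prop) fun t => ?_
      exact (Z.mem_localTriv_target i _).2 (hγ t)
    have hval : ∀ z g, (Z.localTriv i).toOpenPartialHomeomorph.symm (z, (c i x)⁻¹ * g) =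
        mkE z (c i z * (c i x)⁻¹ * g) := by
      intro z g
      refine (Z.localTriv_symm_apply i _).trans ?_
      simp only [mkE, Z, cocycleBundle, mul_assoc]
    have hlift : (fun t => (Z.localTriv i).toOpenPartialHomeomorph.symm (γ t, (c i x)⁻¹ * g)) =
        cov.liftPath γ (mkE x g) γ.source := by
      rw [cov.eq_liftPath_iff]
      refine ⟨hcont, ?_, ?_⟩
      · funext t
        simp only [Function.comp_apply, hval]; rfl
      · simp [hval]
    have h1 := congr_fun hlift 1
    simp only [Path.target, hval] at h1
    change gl (cov.liftPath γ (mkE x g) γ.source 1) = _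
    rw [← h1, gl_mk]

/-- A property of homotopy classes of paths that is stable under concatenation and holds for the
paths inside the members of an open cover holds for all paths inside the union of the cover. -/
theorem path_class_induction {X ι : Type*} [TopologicalSpace X] (U : ι → Set X)
    (hU : ∀ i, IsOpen (U i)) (P : ∀ x y : X, Path.Homotopic.Quotient x y → Prop)
    (htrans : ∀ x y z p q, P x y p → P y z q → P x z (p.trans q))
    (hbase : ∀ i x y (γ : Path x y), (∀ t, γ t ∈ U i) → P x y (.mk γ))
    {x y : X} (γ : Path x y) (hγ : ∀ t, ∃ i, γ t ∈ U i) : P x y (.mk γ) := by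
  obtain ⟨t, t0, tmono, ⟨N, hN⟩, ht⟩ := exists_monotone_Icc_subset_open_cover_unitInterval
    (c := fun i => γ ⁻¹' U i) (fun i => (hU i).preimage γ.continuous)
    (fun s _ => by simpa using hγ s)
  have key : ∀ n, P _ _ (.mk (γ.subpath (t 0) (t n))) := by
    intro n
    induction n with
    | zero =>
      obtain ⟨i, hi⟩ := hγ (t 0)
      refine hbase i _ _ _ fun s => ?_
      simpa using hi
    | succ n ih =>
      obtain ⟨i, hi⟩ := ht n
      have h2 : P _ _ (.mk (γ.subpath (t n) (t (n + 1)))) := by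
        refine hbase i _ _ _ fun s => ?_
        have : γ.subpath (t n) (t (n + 1)) s ∈ range (γ.subpath (t n) (t (n + 1))) := ⟨s, rfl⟩
        rw [Path.range_subpath_of_le _ _ _ (tmono n.le_succ)] at this
        obtain ⟨r, hr, hrs⟩ := this
        rw [← hrs]
        exact hi hr
      have h3 := htrans _ _ _ _ _ ih h2
      rw [← Path.Homotopic.Quotient.mk_trans] at h3
      have h4 := Path.Homotopic.Quotient.eq.2
        ⟨Path.Homotopy.subpathTransSubpath γ (t 0) (t n) (t (n + 1))⟩
      rwa [h4] at h3
  have cast : ∀ {a b : X} (h : a = x) (h' : b = y),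
      P a b ((Path.Homotopic.Quotient.mk γ).cast h h') → P x y (.mk γ) := by
    rintro a b rfl rfl h
    simpa using h
  have h5 := key N
  rw [t0, hN N le_rfl, Path.subpath_zero_one, Path.Homotopic.Quotient.mk_cast] at h5
  exact cast _ _ h5

namespace IsSimplyConnected

variable {X : Type*} [TopologicalSpace X] {S S' : Set X} {x y z : X}

/-- The unique homotopy class of paths inside a simply connected set joining two of its points. -/
def path (hS : IsSimplyConnected S) (hx : x ∈ S) (hy : y ∈ S) : Path.Homotopic.Quotient x y :=
  .mk (hS.isPathConnected.joinedIn x hx y hy).somePath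

theorem mk_eq_path (hS : IsSimplyConnected S) (hx : x ∈ S) (hy : y ∈ S) (γ : Path x y)
    (hγ : ∀ t, γ t ∈ S) : .mk γ = hS.path hx hy := by
  have := hS.simplyConnectedSpace
  have h := hS.isPathConnected.joinedIn x hx y hy
  let f : C(S, X) := ⟨Subtype.val, continuous_subtype_val⟩
  let γ₁ : Path (⟨x, hx⟩ : S) ⟨y, hy⟩ := ⟨⟨fun t => ⟨γ t, hγ t⟩, by fun_prop⟩, by simp, by simp⟩
  let γ₂ : Path (⟨x, hx⟩ : S) ⟨y, hy⟩ :=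
    ⟨⟨fun t => ⟨h.somePath t, h.somePath_mem t⟩, by fun_prop⟩, by simp, by simp⟩
  exact congrArg (fun p => Path.Homotopic.Quotient.map p f)
    (Subsingleton.elim (Path.Homotopic.Quotient.mk γ₁) (Path.Homotopic.Quotient.mk γ₂))

theorem path_eq_path (hS : IsSimplyConnected S) (hS' : IsSimplyConnected S') (hx : x ∈ S)
    (hx' : x ∈ S') (hy : y ∈ S) (hy' : y ∈ S') (h : JoinedIn (S ∩ S') x y) :
    hS.path hx hy = hS'.path hx' hy' := by
  rw [← mk_eq_path hS hx hy h.somePath fun t => (h.somePath_mem t).1,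
    ← mk_eq_path hS' hx' hy' h.somePath fun t => (h.somePath_mem t).2]

theorem path_trans (hS : IsSimplyConnected S) (hx : x ∈ S) (hy : y ∈ S) (hz : z ∈ S) :
    (hS.path hx hy).trans (hS.path hy hz) = hS.path hx hz := by
  rw [path, path, ← Path.Homotopic.Quotient.mk_trans]
  refine mk_eq_path hS hx hz _ fun t => ?_
  rw [Path.trans_apply]
  split_ifs
  exacts [JoinedIn.somePath_mem _ _, JoinedIn.somePath_mem _ _]

theorem path_symm (hS : IsSimplyConnected S) (hx : x ∈ S) (hy : y ∈ S) :
    (hS.path hx hy).symm = hS.path hy hx := by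
  rw [path, ← Path.Homotopic.Quotient.mk_symm]
  exact mk_eq_path hS hy hx _ fun t => JoinedIn.somePath_mem _ _

theorem path_self (hS : IsSimplyConnected S) (hx hx' : x ∈ S) :
    hS.path hx hx' = .refl x :=
  (mk_eq_path hS hx hx' (Path.refl x) fun _ => hx).symm

end IsSimplyConnected

/-- A van Kampen type generation statement: a subgroup of the fundamental group that contains the
loops running out in one member of a simply connected open cover and back in another one contains
all loops in the union of the cover. -/
theorem mem_of_forall_path_trans_path_mem {X ι : Type*} [TopologicalSpace X] {b : X}
    (S : ι → Set X) (hS : ∀ i, IsOpen (S i)) (hsc : ∀ i, IsSimplyConnected (S i))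
    (hb : ∀ i, b ∈ S i) (H : Subgroup (FundamentalGroup X b))
    (hH : ∀ i j x (hi : x ∈ S i) (hj : x ∈ S j),
      (((hsc i).path (hb i) hi).trans ((hsc j).path hj (hb j)) : FundamentalGroup X b) ∈ H)
    (x y : X) (γ : Path x y) (hγ : ∀ t, ∃ i, γ t ∈ S i) (i j : ι) (hx : x ∈ S i) (hy : y ∈ S j) :
    ((((hsc i).path (hb i) hx).trans (.mk γ)).trans ((hsc j).path hy (hb j)) :
      FundamentalGroup X b) ∈ H := by
  have := path_class_induction S hS (fun x y q => (∃ j, y ∈ S j) ∧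
    ∀ i j (hx : x ∈ S i) (hy : y ∈ S j),
      ((((hsc i).path (hb i) hx).trans q).trans ((hsc j).path hy (hb j)) :
        FundamentalGroup X b) ∈ H) ?_ ?_ γ hγ
  · exact this.2 i j hx hy
  · rintro x y z p q ⟨⟨k, hk⟩, hp⟩ ⟨hz, hq⟩
    refine ⟨hz, fun i j hx hz => ?_⟩
    have h := H.mul_mem (hq k j hk hz) (hp i k hx hk)
    rw [FundamentalGroup.mul_def, Path.Homotopic.Quotient.trans_assoc _ ((hsc k).path hk (hb k)),
      ← Path.Homotopic.Quotient.trans_assoc ((hsc k).path hk (hb k)),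
      ← Path.Homotopic.Quotient.trans_assoc ((hsc k).path hk (hb k)), (hsc k).path_trans,
      (hsc k).path_self, Path.Homotopic.Quotient.refl_trans] at h
    simpa only [Path.Homotopic.Quotient.trans_assoc] using h
  · intro k x y γ hγ
    have hx' : x ∈ S k := by simpa using hγ 0
    have hy' : y ∈ S k := by simpa using hγ 1
    refine ⟨⟨k, hy'⟩, fun i j hx hy => ?_⟩
    rw [(hsc k).mk_eq_path hx' hy' γ hγ]
    have h := H.mul_mem (hH k j y hy' hy) (hH i k x hx hx')
    rw [FundamentalGroup.mul_def, Path.Homotopic.Quotient.trans_assoc _ ((hsc k).path hx' (hb k)),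
      ← Path.Homotopic.Quotient.trans_assoc ((hsc k).path hx' (hb k)), (hsc k).path_trans] at h
    simpa only [Path.Homotopic.Quotient.trans_assoc] using h

/-- An open cover by three simply connected sets, two of which meet in `n + 1` path connected
strips, such that the third one glues the first strip to the last one by a double twist. -/
structure StripCover (X : Type*) [TopologicalSpace X] (n : ℕ) where
  A : Set X
  B : Set X
  V : Set X
  /-- the index of the strip containing a point of `A ∩ B` -/
  strip : X → ℕ
  /-- the sheet of a point of `V ∩ A` -/
  sheetA : X → Prop
  /-- the sheet of a point of `V ∩ B` -/
  sheetB : X → Prop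
  isOpen_A : IsOpen A
  isOpen_B : IsOpen B
  isOpen_V : IsOpen V
  isSimplyConnected_A : IsSimplyConnected A
  isSimplyConnected_B : IsSimplyConnected B
  isSimplyConnected_V : IsSimplyConnected V
  cover : ∀ x, x ∈ A ∨ x ∈ B ∨ x ∈ V
  strip_eventually_eq : ∀ x ∈ A, x ∈ B → ∀ᶠ y in 𝓝 x, strip y = strip x
  strip_le : ∀ x ∈ A, x ∈ B → strip x ≤ n
  isPathConnected_strip : ∀ k ≤ n, IsPathConnected {x | (x ∈ A ∧ x ∈ B) ∧ strip x = k}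
  isPathConnected_inter : IsPathConnected (V ∩ (A ∪ B))
  sheetA_eventually_iff : ∀ x ∈ V, x ∈ A → ∀ᶠ y in 𝓝 x, (sheetA y ↔ sheetA x)
  sheetB_eventually_iff : ∀ x ∈ V, x ∈ B → ∀ᶠ y in 𝓝 x, (sheetB y ↔ sheetB x)
  sheet_iff : ∀ x ∈ V, x ∈ A → x ∈ B →
    (strip x = 0 ∧ (sheetA x ↔ sheetB x)) ∨ (strip x = n ∧ (sheetA x ↔ ¬ sheetB x))
  exists_square : ∃ p₁ p₂ p₃ p₄, ((p₁ ∈ A ∧ p₁ ∈ B) ∧ strip p₁ = 0) ∧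
    ((p₂ ∈ A ∧ p₂ ∈ B) ∧ strip p₂ = n) ∧ ((p₃ ∈ A ∧ p₃ ∈ B) ∧ strip p₃ = 0) ∧
    ((p₄ ∈ A ∧ p₄ ∈ B) ∧ strip p₄ = n) ∧ JoinedIn (A ∩ V) p₁ p₂ ∧ JoinedIn (B ∩ V) p₂ p₃ ∧
    JoinedIn (A ∩ V) p₃ p₄ ∧ JoinedIn (B ∩ V) p₄ p₁

namespace StripCover

variable {X : Type*} [TopologicalSpace X] {n : ℕ} (C : StripCover X n)

/-- The partial products of the generators. -/
def partialProd (n k : ℕ) : PresentedGroup (relAn n) :=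
  ((List.ofFn fun i : Fin n => (PresentedGroup.of i : PresentedGroup (relAn n))).take k).prod

theorem partialProd_zero : partialProd n 0 = 1 := by simp [partialProd]

theorem partialProd_succ (k : Fin n) :
    partialProd n (k + 1) = partialProd n k * PresentedGroup.of k := by
  simp [partialProd, List.prod_take_succ]

theorem partialProd_self_mul_self : partialProd n n * partialProd n n = 1 := by
  have h : PresentedGroup.mk (relAn n)
      (((List.ofFn fun i : Fin n => FreeGroup.of i).prod) ^ 2) = 1 :=
    PresentedGroup.one_of_mem rfl
  rw [map_pow, map_list_prod, List.map_ofFn, pow_two] at h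
  rw [partialProd, List.take_of_length_le (by simp)]
  exact h

variable (b : X) (hA : b ∈ C.A) (hB : b ∈ C.B)

/-- The loop running from the base point to `x` inside `A` and back inside `B`. -/
def loop {x : X} (hx : x ∈ C.A ∧ x ∈ C.B) : FundamentalGroup X b :=
  (C.isSimplyConnected_A.path hA hx.1).trans (C.isSimplyConnected_B.path hx.2 hB)

theorem loop_eq_loop {x y : X} (hx : x ∈ C.A ∧ x ∈ C.B) (hy : y ∈ C.A ∧ y ∈ C.B)
    (h : C.strip x = C.strip y) : C.loop b hA hB hx = C.loop b hA hB hy := by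
  have hj := (C.isPathConnected_strip _ (C.strip_le x hx.1 hx.2)).joinedIn x ⟨hx, rfl⟩ y
    ⟨hy, h.symm⟩
  have e := C.isSimplyConnected_A.path_eq_path C.isSimplyConnected_B hx.1 hx.2 hy.1 hy.2
    (hj.mono fun z hz => hz.1)
  unfold loop
  rw [← C.isSimplyConnected_A.path_trans hA hx.1 hy.1, e, Path.Homotopic.Quotient.trans_assoc,
    C.isSimplyConnected_B.path_trans]

theorem loop_self : C.loop b hA hB ⟨hA, hB⟩ = 1 := by
  unfold loop
  rw [C.isSimplyConnected_A.path_self, C.isSimplyConnected_B.path_self,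
    Path.Homotopic.Quotient.trans_refl]
  rfl

theorem prod_ofFn_inv_mul_succ {G : Type*} [Group G] (f : ℕ → G) (hf : f 0 = 1) (n : ℕ) :
    (List.ofFn fun k : Fin n => (f k)⁻¹ * f (k + 1)).prod = f n := by
  induction n with
  | zero => simp [hf]
  | succ n ih =>
    rw [List.ofFn_succ', List.concat_eq_append, List.prod_append]
    simp [ih]

theorem symm_trans_eq {X : Type*} [TopologicalSpace X] {x y z : X}
    (p : Path.Homotopic.Quotient x y) (q : Path.Homotopic.Quotient y z) :
    (p.trans q).symm = q.symm.trans p.symm := by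
  induction p, q using Path.Homotopic.Quotient.ind₂ with | _ p q
  rw [← Path.Homotopic.Quotient.mk_trans, ← Path.Homotopic.Quotient.mk_symm, Path.trans_symm,
    Path.Homotopic.Quotient.mk_trans, Path.Homotopic.Quotient.mk_symm,
    Path.Homotopic.Quotient.mk_symm]

/-- The loop passing through the strip of index `k`. -/
def stripLoop (k : ℕ) : FundamentalGroup X b :=
  if h : k ≤ n then C.loop b hA hB (C.isPathConnected_strip k h).nonempty.some_mem.1 else 1

theorem loop_eq_stripLoop {x : X} (hx : x ∈ C.A ∧ x ∈ C.B) :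
    C.loop b hA hB hx = C.stripLoop b hA hB (C.strip x) := by
  have h := C.strip_le x hx.1 hx.2
  rw [stripLoop, dif_pos h]
  exact C.loop_eq_loop b hA hB hx _ (C.isPathConnected_strip _ h).nonempty.some_mem.2.symm

theorem stripLoop_zero (h : C.strip b = 0) : C.stripLoop b hA hB 0 = 1 := by
  rw [← h, ← C.loop_eq_stripLoop b hA hB ⟨hA, hB⟩, C.loop_self]

theorem stripLoop_mul_self (hb : C.strip b = 0) (hbV : b ∈ C.V) {p₂ p₃ p₄ : X}
    (h₂ : (p₂ ∈ C.A ∧ p₂ ∈ C.B) ∧ C.strip p₂ = n)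
    (h₃ : (p₃ ∈ C.A ∧ p₃ ∈ C.B) ∧ C.strip p₃ = 0)
    (h₄ : (p₄ ∈ C.A ∧ p₄ ∈ C.B) ∧ C.strip p₄ = n) (h₁₂ : JoinedIn (C.A ∩ C.V) b p₂)
    (h₂₃ : JoinedIn (C.B ∩ C.V) p₂ p₃) (h₃₄ : JoinedIn (C.A ∩ C.V) p₃ p₄)
    (h₄₁ : JoinedIn (C.B ∩ C.V) p₄ b) :
    C.stripLoop b hA hB n * C.stripLoop b hA hB n = 1 := by
  have hj := (C.isPathConnected_strip 0 n.zero_le).joinedIn b ⟨⟨hA, hB⟩, hb⟩ p₃ h₃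
  have e₁₃ := C.isSimplyConnected_A.path_eq_path C.isSimplyConnected_B hA hB h₃.1.1 h₃.1.2
    (hj.mono fun z hz => hz.1)
  have e₁₂ := C.isSimplyConnected_A.path_eq_path C.isSimplyConnected_V hA hbV h₂.1.1
    h₁₂.target_mem.2 h₁₂
  have e₂₃ := C.isSimplyConnected_B.path_eq_path C.isSimplyConnected_V h₂.1.2 h₁₂.target_mem.2
    h₃.1.2 h₂₃.target_mem.2 h₂₃
  have e₃₄ := C.isSimplyConnected_A.path_eq_path C.isSimplyConnected_V h₃.1.1 h₂₃.target_mem.2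
    h₄.1.1 h₃₄.target_mem.2 h₃₄
  have e₄₁ := C.isSimplyConnected_B.path_eq_path C.isSimplyConnected_V h₄.1.2 h₃₄.target_mem.2
    hB hbV h₄₁
  have key : ((C.isSimplyConnected_A.path hA h₂.1.1).trans
      (C.isSimplyConnected_B.path h₂.1.2 hB)).trans
      ((C.isSimplyConnected_A.path hA h₄.1.1).trans
      (C.isSimplyConnected_B.path h₄.1.2 hB)) = .refl b := by
    rw [← C.isSimplyConnected_A.path_trans hA h₃.1.1 h₄.1.1, e₁₃,
      Path.Homotopic.Quotient.trans_assoc, Path.Homotopic.Quotient.trans_assoc,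
      ← Path.Homotopic.Quotient.trans_assoc (C.isSimplyConnected_B.path h₂.1.2 hB),
      C.isSimplyConnected_B.path_trans, e₁₂, e₂₃, e₃₄, e₄₁, C.isSimplyConnected_V.path_trans,
      C.isSimplyConnected_V.path_trans, C.isSimplyConnected_V.path_trans,
      C.isSimplyConnected_V.path_self]
  have e₂ := (C.loop_eq_stripLoop b hA hB h₂.1).trans (congrArg _ h₂.2)
  have e₄ := (C.loop_eq_stripLoop b hA hB h₄.1).trans (congrArg _ h₄.2)
  nth_rewrite 1 [← e₄]
  rw [← e₂]
  exact key

/-- The homomorphism sending the generators to the loops around the walls between the strips. -/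
def toFundamentalGroup (h : C.strip b = 0)
    (hsq : C.stripLoop b hA hB n * C.stripLoop b hA hB n = 1) :
    PresentedGroup (relAn n) →* FundamentalGroup X b :=
  PresentedGroup.toGroup (rels := relAn n)
    (f := fun k : Fin n => (C.stripLoop b hA hB k)⁻¹ * C.stripLoop b hA hB (k + 1)) <| by
    rintro _ rfl
    rw [map_pow, map_list_prod, List.map_ofFn, pow_two]
    simp only [Function.comp_def, FreeGroup.lift_apply_of,
      prod_ofFn_inv_mul_succ _ (C.stripLoop_zero b hA hB h), hsq]

theorem toFundamentalGroup_of (h : C.strip b = 0)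
    (hsq : C.stripLoop b hA hB n * C.stripLoop b hA hB n = 1) (k : Fin n) :
    C.toFundamentalGroup b hA hB h hsq (.of k) =
      (C.stripLoop b hA hB k)⁻¹ * C.stripLoop b hA hB (k + 1) :=
  PresentedGroup.toGroup.of _

theorem stripLoop_mem_range (h : C.strip b = 0)
    (hsq : C.stripLoop b hA hB n * C.stripLoop b hA hB n = 1) (k : ℕ) :
    C.stripLoop b hA hB k ∈ (C.toFundamentalGroup b hA hB h hsq).range := by
  induction k with
  | zero => rw [C.stripLoop_zero b hA hB h]; exact one_mem _
  | succ k ih =>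
    by_cases hk : k < n
    · have := mul_mem ih (MonoidHom.mem_range.2
        ⟨_, C.toFundamentalGroup_of b hA hB h hsq ⟨k, hk⟩⟩)
      rwa [mul_inv_cancel_left] at this
    · rw [stripLoop, dif_neg (by omega)]
      exact one_mem _

theorem toFundamentalGroup_surjective (hbV : b ∈ C.V) (h : C.strip b = 0)
    (hsq : C.stripLoop b hA hB n * C.stripLoop b hA hB n = 1) :
    Function.Surjective (C.toFundamentalGroup b hA hB h hsq) := by
  rw [← MonoidHom.range_eq_top, Subgroup.eq_top_iff']
  set H := (C.toFundamentalGroup b hA hB h hsq).range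
  let S₂ : Bool → Set X := fun i => i.rec C.A C.B
  have S₂_open : ∀ i, IsOpen (S₂ i) := by rintro (_ | _); exacts [C.isOpen_A, C.isOpen_B]
  have S₂_sc : ∀ i, IsSimplyConnected (S₂ i) := by
    rintro (_ | _); exacts [C.isSimplyConnected_A, C.isSimplyConnected_B]
  have S₂_b : ∀ i, b ∈ S₂ i := by rintro (_ | _); exacts [hA, hB]
  have hrefl : ∀ q : Path.Homotopic.Quotient b b, q = .refl b → (q : FundamentalGroup X b) ∈ H := by
    rintro q rfl
    exact one_mem _
  have hsymm : ∀ q : Path.Homotopic.Quotient b b, (q : FundamentalGroup X b) ∈ H →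
      (q.symm : FundamentalGroup X b) ∈ H := fun q hq => inv_mem hq
  have hAB : ∀ x (hx : x ∈ C.A) (hx' : x ∈ C.B), ((C.isSimplyConnected_A.path hA hx).trans
      (C.isSimplyConnected_B.path hx' hB) : FundamentalGroup X b) ∈ H := by
    intro x hx hx'
    have := C.stripLoop_mem_range b hA hB h hsq (C.strip x)
    rwa [← C.loop_eq_stripLoop b hA hB ⟨hx, hx'⟩] at this
  have h₂ := mem_of_forall_path_trans_path_mem S₂ S₂_open S₂_sc S₂_b H (by
    rintro (_ | _) (_ | _) x hi hj
    · exact hrefl _ (by rw [IsSimplyConnected.path_trans, IsSimplyConnected.path_self])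
    · exact hAB x hi hj
    · have := hsymm _ (hAB x hj hi)
      rwa [symm_trans_eq, IsSimplyConnected.path_symm,
        IsSimplyConnected.path_symm] at this
    · exact hrefl _ (by rw [IsSimplyConnected.path_trans, IsSimplyConnected.path_self]))
  have hV : ∀ i x (hi : x ∈ S₂ i) (hx : x ∈ C.V), ((C.isSimplyConnected_V.path hbV hx).trans
      ((S₂_sc i).path hi (S₂_b i)) : FundamentalGroup X b) ∈ H := by
    intro i x hi hx
    have hj := C.isPathConnected_inter.joinedIn b ⟨hbV, .inl hA⟩ x
      ⟨hx, by cases i; exacts [.inl hi, .inr hi]⟩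
    have := h₂ _ _ hj.somePath (fun t => (hj.somePath_mem t).2.elim (fun h => ⟨false, h⟩)
      fun h => ⟨true, h⟩) false i hA hi
    rwa [IsSimplyConnected.path_self, Path.Homotopic.Quotient.refl_trans,
      C.isSimplyConnected_V.mk_eq_path hbV hx _ fun t => (hj.somePath_mem t).1] at this
  let S₃ : Option Bool → Set X := fun i => i.rec C.V S₂
  have S₃_open : ∀ i, IsOpen (S₃ i) := by rintro (_ | _); exacts [C.isOpen_V, S₂_open _]
  have S₃_sc : ∀ i, IsSimplyConnected (S₃ i) := by
    rintro (_ | _); exacts [C.isSimplyConnected_V, S₂_sc _]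
  have S₃_b : ∀ i, b ∈ S₃ i := by rintro (_ | _); exacts [hbV, S₂_b _]
  have h₃ := mem_of_forall_path_trans_path_mem S₃ S₃_open S₃_sc S₃_b H (by
    rintro (_ | i) (_ | j) x hi hj
    · exact hrefl _ (by rw [IsSimplyConnected.path_trans, IsSimplyConnected.path_self])
    · exact hV j x hj hi
    · have := hsymm _ (hV i x hi hj)
      rwa [symm_trans_eq, IsSimplyConnected.path_symm,
        IsSimplyConnected.path_symm] at this
    · have := h₂ _ _ (Path.refl x) (fun t => ⟨i, hi⟩) i j hi hj
      rwa [Path.Homotopic.Quotient.mk_refl, Path.Homotopic.Quotient.trans_refl] at this)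
  intro (q : Path.Homotopic.Quotient b b)
  induction q using Path.Homotopic.Quotient.ind with | mk γ => ?_
  have := h₃ _ _ γ (fun t => (C.cover (γ t)).elim (fun h => ⟨some false, h⟩) fun h =>
    h.elim (fun h => ⟨some true, h⟩) fun h => ⟨none, h⟩) none none hbV hbV
  rwa [IsSimplyConnected.path_self, Path.Homotopic.Quotient.refl_trans,
    Path.Homotopic.Quotient.trans_refl] at this

open Classical in
/-- Local sections of the universal cover over the three members of the cover. -/
def sheet : Option Bool → X → PresentedGroup (relAn n)
  | none, x => if x ∈ C.A then (if C.sheetA x then partialProd n n else 1)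
      else (if C.sheetB x then partialProd n n else 1)
  | some false, _ => 1
  | some true, x => if x ∈ C.A ∧ x ∈ C.B then (partialProd n (C.strip x))⁻¹ else 1

/-- The members of the cover as a family. -/
def member : Option Bool → Set X
  | none => C.V
  | some false => C.A
  | some true => C.B

theorem isOpen_member : ∀ i, IsOpen (C.member i)
  | none => C.isOpen_V
  | some false => C.isOpen_A
  | some true => C.isOpen_B

theorem sheet_false_true {x : X} (hA : x ∈ C.A) (hB : x ∈ C.B) :
    (C.sheet (some true) x)⁻¹ * C.sheet (some false) x = partialProd n (C.strip x) := by
  simp [sheet, hA, hB]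

open Classical in
theorem sheet_none_false {x : X} (hA : x ∈ C.A) :
    (C.sheet (some false) x)⁻¹ * C.sheet none x = if C.sheetA x then partialProd n n else 1 := by
  simp [sheet, hA]

open Classical in
theorem sheet_none_true {x : X} (hV : x ∈ C.V) (hB : x ∈ C.B) :
    (C.sheet (some true) x)⁻¹ * C.sheet none x = if C.sheetB x then partialProd n n else 1 := by
  by_cases hA : x ∈ C.A
  · rcases C.sheet_iff x hV hA hB with ⟨h0, h⟩ | ⟨h0, h⟩
    · simp [sheet, hA, hB, h0, h, partialProd_zero]
    · by_cases hs : C.sheetB x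
      · simp [sheet, hA, hB, h0, h, hs]
      · simp [sheet, hA, hB, h0, h, hs, partialProd_self_mul_self]
  · simp [sheet, hA]

theorem sheet_eventually_eq (i j : Option Bool) (x : X) (hi : x ∈ C.member i)
    (hj : x ∈ C.member j) :
    ∀ᶠ y in 𝓝 x, (C.sheet j y)⁻¹ * C.sheet i y = (C.sheet j x)⁻¹ * C.sheet i x := by
  have hsymm : ∀ {i j}, (∀ᶠ y in 𝓝 x, (C.sheet j y)⁻¹ * C.sheet i y =
      (C.sheet j x)⁻¹ * C.sheet i x) → ∀ᶠ y in 𝓝 x, (C.sheet i y)⁻¹ * C.sheet j y =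
      (C.sheet i x)⁻¹ * C.sheet j x := fun h => h.mono fun y hy => by
    simpa using congrArg (·⁻¹) hy
  have hAB : x ∈ C.A → x ∈ C.B → ∀ᶠ y in 𝓝 x, (C.sheet (some true) y)⁻¹ *
      C.sheet (some false) y = (C.sheet (some true) x)⁻¹ * C.sheet (some false) x := by
    intro hA hB
    filter_upwards [C.isOpen_A.mem_nhds hA, C.isOpen_B.mem_nhds hB,
      C.strip_eventually_eq x hA hB] with y hyA hyB hy
    rw [C.sheet_false_true hA hB, C.sheet_false_true hyA hyB, hy]
  have hVA : x ∈ C.V → x ∈ C.A → ∀ᶠ y in 𝓝 x, (C.sheet (some false) y)⁻¹ *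
      C.sheet none y = (C.sheet (some false) x)⁻¹ * C.sheet none x := by
    intro hV hA
    filter_upwards [C.isOpen_A.mem_nhds hA, C.sheetA_eventually_iff x hV hA] with y hyA hy
    rw [C.sheet_none_false hA, C.sheet_none_false hyA, propext hy]
  have hVB : x ∈ C.V → x ∈ C.B → ∀ᶠ y in 𝓝 x, (C.sheet (some true) y)⁻¹ *
      C.sheet none y = (C.sheet (some true) x)⁻¹ * C.sheet none x := by
    intro hV hB
    filter_upwards [C.isOpen_B.mem_nhds hB, C.isOpen_V.mem_nhds hV,
      C.sheetB_eventually_iff x hV hB] with y hyB hyV hy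
    rw [C.sheet_none_true hV hB, C.sheet_none_true hyV hyB, propext hy]
  rcases i with _ | _ | _ <;> rcases j with _ | _ | _
  exacts [by simp, hVA hi hj, hVB hi hj, hsymm (hVA hj hi), by simp, hAB hi hj,
    hsymm (hVB hj hi), hsymm (hAB hj hi), by simp]

theorem toFundamentalGroup_injective (h : C.strip b = 0)
    (hsq : C.stripLoop b hA hB n * C.stripLoop b hA hB n = 1) :
    Function.Injective (C.toFundamentalGroup b hA hB h hsq) := by
  obtain ⟨M, hrefl, htrans, hM⟩ := exists_transport C.member C.isOpen_member
    (fun x => (C.cover x).elim (fun h => ⟨some false, h⟩) fun h =>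
      h.elim (fun h => ⟨some true, h⟩) fun h => ⟨none, h⟩) C.sheet C.sheet_eventually_eq
  have hone : ∀ g, M b b (1 : FundamentalGroup X b) g = g := hrefl b
  have hmul : ∀ (p q : FundamentalGroup X b) g, M b b (p * q : FundamentalGroup X b) g =
      M b b p (M b b q g) := fun p q g => htrans b b b q p g
  have hMA : ∀ x y (hx : x ∈ C.A) (hy : y ∈ C.A) g,
      M x y (C.isSimplyConnected_A.path hx hy) g = g := fun x y hx hy g =>
    (hM (some false) x y _ (fun t => JoinedIn.somePath_mem _ t) g).trans (by simp [sheet])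
  have hMB : ∀ x y (hx : x ∈ C.B) (hy : y ∈ C.B) g,
      M x y (C.isSimplyConnected_B.path hx hy) g =
        C.sheet (some true) y * (C.sheet (some true) x)⁻¹ * g := fun x y hx hy g =>
    hM (some true) x y _ (fun t => JoinedIn.somePath_mem _ t) g
  have hloop : ∀ k ≤ n, ∀ g, M b b (C.stripLoop b hA hB k) g = partialProd n k * g := by
    intro k hk g
    obtain ⟨x, hx, rfl⟩ := (C.isPathConnected_strip k hk).nonempty
    rw [← C.loop_eq_stripLoop b hA hB hx, loop, htrans, hMB, hMA]
    simp [sheet, hx, hA, hB, h, partialProd_zero]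
  let K : Subgroup (PresentedGroup (relAn n)) :=
    { carrier := {u | ∀ g, M b b (C.toFundamentalGroup b hA hB h hsq u) g = u * g}
      one_mem' := fun g => by rw [map_one, hone, one_mul]
      mul_mem' := fun {u v} hu hv g => by rw [map_mul, hmul, hv, hu, mul_assoc]
      inv_mem' := fun {u} hu g => by
        rw [eq_inv_mul_iff_mul_eq, ← hu, ← hmul, ← map_mul, mul_inv_cancel, map_one, hone] }
  have hK : ∀ u, u ∈ K := PresentedGroup.generated_by _ K fun k g => by
    rw [toFundamentalGroup_of, ← mul_right_inj (partialProd n k), ← hloop k k.2.le, ← hmul,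
      mul_inv_cancel_left, hloop _ k.2, partialProd_succ, mul_assoc]
  rw [injective_iff_map_eq_one]
  intro u hu
  have := hK u 1
  rwa [hu, hone, mul_one, eq_comm] at this

theorem isPathConnected_univ (C : StripCover X n) : IsPathConnected (univ : Set X) := by
  have hAB := C.isSimplyConnected_A.isPathConnected.union C.isSimplyConnected_B.isPathConnected
    ((C.isPathConnected_strip 0 n.zero_le).nonempty.mono fun x hx => hx.1)
  have := hAB.union C.isSimplyConnected_V.isPathConnected
    (C.isPathConnected_inter.nonempty.mono fun x hx => ⟨hx.2, hx.1⟩)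
  convert this using 1
  refine (eq_univ_of_forall fun x => ?_).symm
  have := C.cover x
  simp only [mem_union]
  tauto

/-- The fundamental group of a space with a strip cover. -/
theorem nonempty_mulEquiv (C : StripCover X n) (x : X) :
    Nonempty (FundamentalGroup X x ≃* PresentedGroup (relAn n)) := by
  obtain ⟨b, p₂, p₃, p₄, ⟨⟨hA, hB⟩, hb⟩, h₂, h₃, h₄, h₁₂, h₂₃, h₃₄, h₄₁⟩ := C.exists_square
  have hV : b ∈ C.V := h₁₂.source_mem.2
  have hsq := C.stripLoop_mul_self b hA hB hb hV h₂ h₃ h₄ h₁₂ h₂₃ h₃₄ h₄₁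
  have := pathConnectedSpace_iff_univ.2 C.isPathConnected_univ
  exact ⟨(FundamentalGroup.fundamentalGroupMulEquivOfPathConnected x b).trans
    (MulEquiv.ofBijective _ ⟨C.toFundamentalGroup_injective b hA hB hb hsq,
      C.toFundamentalGroup_surjective b hA hB hV hb hsq⟩).symm⟩

end StripCover

/-- A set that can be pushed along segments into one of its convex subsets is contractible. -/
theorem contractibleSpace_of_segment_subset {E : Type*} [AddCommGroup E] [Module ℝ E]
    [TopologicalSpace E] [ContinuousAdd E] [ContinuousSMul ℝ E] {S K : Set E} (r : E → E)
    (hr : Continuous r) (hseg : ∀ x ∈ S, segment ℝ x (r x) ⊆ S) (hrK : ∀ x ∈ S, r x ∈ K)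
    (hK : Convex ℝ K) (hKS : K ⊆ S) (hS : S.Nonempty) : ContractibleSpace S := by
  have := hK.contractibleSpace (hS.elim fun x hx => ⟨_, hrK x hx⟩)
  have e : ContinuousMap.HomotopyEquiv S K :=
    { toFun := ⟨fun x => ⟨r x, hrK x x.2⟩, by fun_prop⟩
      invFun := ⟨fun x => ⟨x, hKS x.2⟩, by fun_prop⟩
      left_inv := ⟨⟨⟨fun p => ⟨p.1.1 • p.2.1 + (1 - p.1.1) • r p.2.1, hseg _ p.2.2
          ⟨p.1.1, 1 - p.1.1, p.1.2.1, sub_nonneg.2 p.1.2.2, by ring, rfl⟩⟩, by fun_prop⟩,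
          fun x => by simp, fun x => by simp⟩⟩
      right_inv := ⟨⟨⟨fun p => ⟨p.1.1 • p.2.1 + (1 - p.1.1) • r p.2.1,
          hK p.2.2 (hrK _ (hKS p.2.2)) p.1.2.1 (sub_nonneg.2 p.1.2.2) (by ring)⟩, by fun_prop⟩,
          fun x => by simp, fun x => by simp⟩⟩ }
  exact e.contractibleSpace

theorem OpenPartialHomeomorph.isSimplyConnected_inter_preimage {X Y : Type*} [TopologicalSpace X]
    [TopologicalSpace Y] (e : OpenPartialHomeomorph X Y) {S : Set Y} (hS : S ⊆ e.target)
    (hc : ContractibleSpace S) : IsSimplyConnected (e.source ∩ e ⁻¹' S) :=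
  have := (e.symm.homeomorphOfImageSubsetSource hS
    (e.symm_image_eq_source_inter_preimage hS)).symm.contractibleSpace
  (inferInstance : SimplyConnectedSpace _)

theorem OpenPartialHomeomorph.isPathConnected_inter_preimage {X Y : Type*} [TopologicalSpace X]
    [TopologicalSpace Y] (e : OpenPartialHomeomorph X Y) {S : Set Y} (hS : S ⊆ e.target)
    (hc : IsPathConnected S) : IsPathConnected (e.source ∩ e ⁻¹' S) := by
  rw [← e.symm_image_eq_source_inter_preimage hS]
  exact hc.image' (e.continuousOn_symm.mono hS)

/-- The plane cut along the horizontal rays starting at the points `T k` in the direction `-s`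
and along a cone in the same direction. -/
def cutPlane {n : ℕ} (T : Fin n → ℂ) (s : ℝ) : Set ℂ :=
  {t | (∀ k, t.im = (T k).im → s * (T k).re < s * t.re) ∧ -(s * t.re) < 1 + |t.im|}

section cutPlane

variable {n : ℕ} {T : Fin n → ℂ} {s : ℝ} {t : ℂ}

theorem isOpen_cutPlane : IsOpen (cutPlane T s) := by
  have h1 : IsOpen {t : ℂ | -(s * t.re) < 1 + |t.im|} :=
    isOpen_lt (by fun_prop) (by fun_prop)
  have h2 : ∀ k, IsOpen {t : ℂ | t.im = (T k).im → s * (T k).re < s * t.re} := fun k => by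
    simp only [imp_iff_not_or]
    exact (isOpen_ne_fun Complex.continuous_im continuous_const).union
      (isOpen_lt continuous_const (continuous_const.mul Complex.continuous_re))
  simpa only [cutPlane, ofPred_and, ofPred_forall] using (isOpen_iInter_of_finite h2).inter h1

theorem ne_of_mem_cutPlane (h : t ∈ cutPlane T s) (k : Fin n) : t ≠ T k := by
  rintro rfl
  exact (h.1 k rfl).false

theorem add_mem_cutPlane (hs : s * s = 1) (h : t ∈ cutPlane T s) {c : ℝ} (hc : 0 ≤ c) :
    t + ↑(c * s) ∈ cutPlane T s := by
  have e : s * (t.re + c * s) = s * t.re + c := by linear_combination c * hs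
  refine ⟨fun k hk => ?_, ?_⟩
  · rw [Complex.add_im, Complex.ofReal_im, add_zero] at hk
    rw [Complex.add_re, Complex.ofReal_re, e]
    linarith [h.1 k hk]
  · rw [Complex.add_re, Complex.add_im, Complex.ofReal_re, Complex.ofReal_im, add_zero, e]
    linarith [h.2]

theorem abs_eq_one_of_mul_self {s : ℝ} (hs : s * s = 1) : |s| = 1 := by
  rcases mul_self_eq_one_iff.1 hs with rfl | rfl <;> simp

theorem mem_cutPlane_of_one_le (hT : ∀ k, ‖T k‖ < 1) (hs : s * s = 1) (h : 1 ≤ s * t.re) :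
    t ∈ cutPlane T s := by
  refine ⟨fun k _ => lt_of_lt_of_le ?_ h, by linarith [abs_nonneg t.im]⟩
  calc s * (T k).re ≤ |s * (T k).re| := le_abs_self _
    _ = |(T k).re| := by rw [abs_mul, abs_eq_one_of_mul_self hs, one_mul]
    _ ≤ ‖T k‖ := Complex.abs_re_le_norm _
    _ < 1 := hT k

theorem contractibleSpace_univ_prod_cutPlane (hT : ∀ k, ‖T k‖ < 1) (hs : s * s = 1) :
    ContractibleSpace ((univ : Set ℂ) ×ˢ cutPlane T s : Set (ℂ × ℂ)) := by
  refine contractibleSpace_of_segment_subset (K := {q : ℂ × ℂ | 1 ≤ s * q.2.re})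
    (fun q => (q.1, q.2 + ↑((1 + |q.2.re|) * s))) (by fun_prop) ?_ ?_ ?_ ?_ ?_
  · rintro ⟨x, t⟩ ⟨-, ht⟩ _ ⟨a, b, ha, hb, hab, rfl⟩
    refine ⟨mem_univ _, ?_⟩
    have := add_mem_cutPlane hs ht (c := b * (1 + |t.re|)) (by positivity)
    convert this using 1
    simp only [Prod.smul_mk, Prod.mk_add_mk, smul_add, Complex.real_smul]
    rw [← add_assoc, ← add_mul, ← Complex.ofReal_add, hab]
    push_cast
    ring
  · rintro ⟨x, t⟩ ⟨-, ht⟩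
    simp only [mem_ofPred_eq, Complex.add_re, Complex.ofReal_re]
    have h1 : |s * t.re| = |t.re| := by rw [abs_mul, abs_eq_one_of_mul_self hs, one_mul]
    have h2 := neg_abs_le (s * t.re)
    linarith [show s * (t.re + (1 + |t.re|) * s) = s * t.re + (1 + |t.re|) by
      linear_combination (1 + |t.re|) * hs]
  · intro p hp q hq a b ha hb hab
    simp only [mem_ofPred_eq, Prod.snd_add, Prod.smul_snd, Complex.add_re, Complex.real_smul,
      Complex.re_ofReal_mul] at *
    nlinarith
  · rintro ⟨x, t⟩ h
    exact ⟨mem_univ _, mem_cutPlane_of_one_le hT hs h⟩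
  · exact ⟨(0, s), mem_univ _, mem_cutPlane_of_one_le hT hs (by simp [hs])⟩

theorem mem_cutPlane_or (hT : ∀ k, ‖T k‖ < 1) (hinj : Function.Injective fun k => (T k).im)
    (h : ∀ k, t ≠ T k) : t ∈ cutPlane T 1 ∨ t ∈ cutPlane T (-1) := by
  have hlt : ∀ k, |(T k).re| < 1 := fun k => (Complex.abs_re_le_norm _).trans_lt (hT k)
  by_cases hk : ∃ k, t.im = (T k).im
  · obtain ⟨k, hk⟩ := hk
    have huniq : ∀ j, t.im = (T j).im → j = k := fun j hj => hinj (hj.symm.trans hk)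
    have := abs_lt.1 (hlt k)
    have h0 := abs_nonneg t.im
    rcases lt_trichotomy t.re (T k).re with hr | hr | hr
    · refine .inr ⟨fun j hj => ?_, by linarith⟩
      rw [huniq j hj]
      linarith
    · exact absurd (Complex.ext hr hk) (h k)
    · refine .inl ⟨fun j hj => ?_, by linarith⟩
      rw [huniq j hj]
      linarith
  · push Not at hk
    rcases le_total 0 t.re with hr | hr
    · exact .inl ⟨fun j hj => absurd hj (hk j), by linarith [abs_nonneg t.im]⟩
    · exact .inr ⟨fun j hj => absurd hj (hk j), by linarith [abs_nonneg t.im]⟩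

theorem im_ne_of_mem_cutPlane (h : t ∈ cutPlane T 1) (h' : t ∈ cutPlane T (-1)) (k : Fin n) :
    t.im ≠ (T k).im := fun hk => by
  linarith [h.1 k hk, h'.1 k hk]

theorem mem_cutPlane_inter (h : ∀ k, t.im ≠ (T k).im) (h' : |t.re| < 1 + |t.im|) :
    t ∈ cutPlane T 1 ∧ t ∈ cutPlane T (-1) := by
  have := abs_lt.1 h'
  exact ⟨⟨fun k hk => absurd hk (h k), by linarith⟩, ⟨fun k hk => absurd hk (h k), by linarith⟩⟩

theorem abs_re_lt_of_mem_cutPlane (h : t ∈ cutPlane T 1) (h' : t ∈ cutPlane T (-1)) :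
    |t.re| < 1 + |t.im| := abs_lt.2 ⟨by linarith [h.2], by linarith [h'.2]⟩

/-- The number of the points `T k` below `t`. -/
def stripIndex (T : Fin n → ℂ) (t : ℂ) : ℕ := (Finset.univ.filter fun k => (T k).im < t.im).card

theorem im_lt_iff_lt_stripIndex (hT : StrictMono fun k => (T k).im) (k : Fin n) :
    (T k).im < t.im ↔ (k : ℕ) < stripIndex T t := by
  constructor
  · intro h
    have : Finset.Iic k ⊆ Finset.univ.filter fun k => (T k).im < t.im := fun j hj => by
      simpa using (hT.monotone (Finset.mem_Iic.1 hj)).trans_lt h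
    have := Finset.card_le_card this
    rw [Fin.card_Iic] at this
    exact this
  · intro h
    by_contra hk
    have : (Finset.univ.filter fun k => (T k).im < t.im) ⊆ Finset.Iio k := fun j hj => by
      rw [Finset.mem_Iio]
      by_contra hj'
      exact hk ((hT.monotone (not_lt.1 hj')).trans_lt (by simpa using hj))
    have := Finset.card_le_card this
    rw [Fin.card_Iio] at this
    exact (h.trans_le this).false

theorem stripIndex_le : stripIndex T t ≤ n := by
  simpa [stripIndex] using Finset.card_filter_le Finset.univ fun k => (T k).im < t.im

theorem stripIndex_eq_zero (h : ∀ k, t.im ≤ (T k).im) : stripIndex T t = 0 := by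
  simpa [stripIndex, Finset.filter_eq_empty_iff] using h

theorem stripIndex_eq_self (h : ∀ k, (T k).im < t.im) : stripIndex T t = n := by
  simp [stripIndex, h]

theorem stripIndex_eventually_eq (h : ∀ k, t.im ≠ (T k).im) :
    ∀ᶠ t' in 𝓝 t, stripIndex T t' = stripIndex T t := by
  have : ∀ k, ∀ᶠ t' in 𝓝 t, ((T k).im < t'.im ↔ (T k).im < t.im) := by
    intro k
    rcases (h k).lt_or_gt with hk | hk
    · filter_upwards [(isOpen_lt Complex.continuous_im continuous_const).mem_nhds hk] with t' ht'
      exact iff_of_false (not_lt.2 (le_of_lt ht')) (not_lt.2 hk.le)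
    · filter_upwards [(isOpen_lt continuous_const Complex.continuous_im).mem_nhds hk] with t' ht'
      exact iff_of_true ht' hk
  filter_upwards [Filter.eventually_all.2 this] with t' ht'
  simp only [stripIndex, ht']

theorem isPathConnected_strip (hT : StrictMono fun k => (T k).im) {m : ℕ} (hm : m ≤ n) :
    IsPathConnected {q : ℂ × ℂ | (q.2 ∈ cutPlane T 1 ∧ q.2 ∈ cutPlane T (-1)) ∧
      stripIndex T q.2 = m} := by
  set S := {q : ℂ × ℂ | (q.2 ∈ cutPlane T 1 ∧ q.2 ∈ cutPlane T (-1)) ∧ stripIndex T q.2 = m}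
    with hSdef
  have hmem : ∀ q : ℂ × ℂ, q ∈ S ↔ (∀ k : Fin n, ((k : ℕ) < m → (T k).im < q.2.im) ∧
      (m ≤ k → q.2.im < (T k).im)) ∧ |q.2.re| < 1 + |q.2.im| := by
    rintro ⟨x, t⟩
    constructor
    · rintro ⟨⟨h, h'⟩, rfl⟩
      refine ⟨fun k => ⟨(im_lt_iff_lt_stripIndex hT k).2, fun hk => ?_⟩,
        abs_re_lt_of_mem_cutPlane h h'⟩
      rw [← not_lt, ← im_lt_iff_lt_stripIndex hT k, not_lt] at hk
      exact hk.lt_of_ne (im_ne_of_mem_cutPlane h h' k)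
    · rintro ⟨h, h'⟩
      refine ⟨mem_cutPlane_inter (fun k => ?_) h', ?_⟩
      · rcases lt_or_ge (k : ℕ) m with hk | hk
        exacts [((h k).1 hk).ne', ((h k).2 hk).ne]
      · have : (Finset.univ.filter fun k => (T k).im < t.im) =
            Finset.univ.filter fun k : Fin n => (k : ℕ) < m := by
          ext k
          simp only [Finset.mem_filter, Finset.mem_univ, true_and]
          exact ⟨fun hk => not_le.1 fun hk' => hk.not_gt ((h k).2 hk'), (h k).1⟩
        rw [stripIndex, this, Fin.card_filter_val_lt, min_eq_right hm]
  have hne : ∃ v : ℝ, ∀ k : Fin n, ((k : ℕ) < m → (T k).im < v) ∧ (m ≤ k → v < (T k).im) := by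
    obtain ⟨v, h₁, h₂⟩ := Order.exists_between_finsets
      ((Finset.univ.filter fun k : Fin n => (k : ℕ) < m).image fun k => (T k).im)
      ((Finset.univ.filter fun k : Fin n => m ≤ (k : ℕ)).image fun k => (T k).im) (by
        simp only [Finset.mem_image, Finset.mem_filter, Finset.mem_univ, true_and]
        rintro _ ⟨j, hj, rfl⟩ _ ⟨k, hk, rfl⟩
        exact hT (Fin.lt_def.2 (by omega)))
    exact ⟨v, fun k => ⟨fun hk => h₁ _ (Finset.mem_image_of_mem _ (by simpa using hk)),
      fun hk => h₂ _ (Finset.mem_image_of_mem _ (by simpa using hk))⟩⟩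
  have : ContractibleSpace S := by
    refine contractibleSpace_of_segment_subset (K := {q : ℂ × ℂ | (∀ k : Fin n,
      ((k : ℕ) < m → (T k).im < q.2.im) ∧ (m ≤ k → q.2.im < (T k).im)) ∧ q.2.re = 0})
      (fun q => (q.1, q.2.im * Complex.I)) (by fun_prop) ?_ ?_ ?_ ?_ ?_
    · rintro ⟨x, t⟩ hq _ ⟨a, b, ha, hb, hab, rfl⟩
      rw [hmem] at hq ⊢
      obtain rfl : b = 1 - a := by linarith
      have e : (a • t + (1 - a) • (t.im * Complex.I)).im = t.im := by
        simp only [Complex.add_im, Complex.real_smul, Complex.im_ofReal_mul, Complex.I_im]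
        ring
      have e' : (a • t + (1 - a) • (t.im * Complex.I)).re = a * t.re := by
        simp
      simp only [Prod.smul_mk, Prod.mk_add_mk, e, e']
      refine ⟨hq.1, lt_of_le_of_lt ?_ hq.2⟩
      rw [abs_mul, abs_of_nonneg ha]
      exact mul_le_of_le_one_left (abs_nonneg _) (by linarith)
    · rintro ⟨x, t⟩ hq
      rw [hmem] at hq
      simpa using hq.1
    · rintro p ⟨hp, hp'⟩ q ⟨hq, hq'⟩ a b ha hb hab
      obtain rfl : b = 1 - a := by linarith
      refine ⟨fun k => ⟨fun hk => ?_, fun hk => ?_⟩, by simp [hp', hq']⟩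
      · have := (convex_Ioi (T k).im) ((hp k).1 hk) ((hq k).1 hk) ha hb hab
        simpa using this
      · have := (convex_Iio (T k).im) ((hp k).2 hk) ((hq k).2 hk) ha hb hab
        simpa using this
    · rintro q ⟨hq, hq'⟩
      rw [hmem]
      exact ⟨hq, by rw [hq', abs_zero]; positivity⟩
    · obtain ⟨v, hv⟩ := hne
      refine ⟨(0, v * Complex.I), (hmem _).2 ⟨by simpa using hv, ?_⟩⟩
      simp only [Complex.re_ofReal_mul, Complex.I_re, mul_zero, abs_zero]
      positivity
  exact isPathConnected_iff_pathConnectedSpace.2 inferInstance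

end cutPlane

section doubleCover

variable {n : ℕ} {T : Fin n → ℂ} {c x t : ℂ}

theorem re_im_mul_sq (c x : ℂ) :
    (c * x ^ 2).re = c.re * (x.re ^ 2 - x.im ^ 2) - c.im * (2 * x.re * x.im) ∧
    (c * x ^ 2).im = c.re * (2 * x.re * x.im) + c.im * (x.re ^ 2 - x.im ^ 2) := by
  simp only [pow_two, Complex.mul_re, Complex.mul_im]
  constructor <;> ring

theorem re_im_bounds (hc : ‖c - 1‖ < 1 / 4) :
    3 / 4 < c.re ∧ c.re < 5 / 4 ∧ -(1 / 4) < c.im ∧ c.im < 1 / 4 := by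
  have h1 := abs_lt.1 ((Complex.abs_re_le_norm _).trans_lt hc)
  have h2 := abs_lt.1 ((Complex.abs_im_le_norm _).trans_lt hc)
  simp only [Complex.sub_re, Complex.one_re, Complex.sub_im, Complex.one_im, sub_zero] at h1 h2
  exact ⟨by linarith, by linarith, h2.1, h2.2⟩

theorem re_sq_add_im_sq (hx : 10 < ‖x‖) : 100 < x.re ^ 2 + x.im ^ 2 := by
  have := Complex.sq_norm x
  rw [Complex.normSq_apply] at this
  nlinarith

theorem re_ne_zero_of_mem_cutPlane (hc : ‖c - 1‖ < 1 / 4) (hx : 10 < ‖x‖)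
    (h : c * x ^ 2 ∈ cutPlane T 1) : x.re ≠ 0 := fun h0 => by
  obtain ⟨h1, h2, h3, h4⟩ := re_im_bounds hc
  have h5 := re_sq_add_im_sq hx
  have h6 := h.2
  rw [(re_im_mul_sq c x).1, (re_im_mul_sq c x).2, h0] at h6
  rw [h0] at h5
  have h7 : |c.re * (2 * 0 * x.im) + c.im * (0 ^ 2 - x.im ^ 2)| ≤ 1 / 4 * x.im ^ 2 :=
    abs_le.2 ⟨by nlinarith, by nlinarith⟩
  have h8 := mul_le_mul_of_nonneg_right h1.le (sq_nonneg x.im)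
  have h9 := h6.trans_le (add_le_add_right h7 1)
  linarith

theorem im_ne_zero_of_mem_cutPlane (hc : ‖c - 1‖ < 1 / 4) (hx : 10 < ‖x‖)
    (h : c * x ^ 2 ∈ cutPlane T (-1)) : x.im ≠ 0 := fun h0 => by
  obtain ⟨h1, h2, h3, h4⟩ := re_im_bounds hc
  have h5 := re_sq_add_im_sq hx
  have h6 := h.2
  rw [(re_im_mul_sq c x).1, (re_im_mul_sq c x).2, h0] at h6
  rw [h0] at h5
  have h7 : |c.re * (2 * x.re * 0) + c.im * (x.re ^ 2 - 0 ^ 2)| ≤ 1 / 4 * x.re ^ 2 :=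
    abs_le.2 ⟨by nlinarith, by nlinarith⟩
  have h8 := mul_le_mul_of_nonneg_right h1.le (sq_nonneg x.re)
  have h9 := h6.trans_le (add_le_add_right h7 1)
  linarith

/-- The linear estimate behind `one_lt_im_of_mul_pos`. -/
theorem one_lt_of_abs_lt {a b u v : ℝ} (hu : 3 / 4 < u) (hv : -(1 / 4) < v)
    (hv' : v < 1 / 4) (hab : 100 < |a| + |b|) (hb : 0 < b)
    (h : |u * a - v * b| < 1 + |u * b + v * a|) : 1 < u * b + v * a := by
  by_contra hle
  push Not at hle
  rw [abs_of_pos hb] at hab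
  have h1 : |v * a| ≤ 1 / 4 * |a| := by
    rw [abs_mul]
    exact mul_le_mul_of_nonneg_right (abs_le.2 ⟨hv.le, hv'.le⟩) (abs_nonneg a)
  have h2 : |v * b| ≤ 1 / 4 * b := by
    rw [abs_mul, abs_of_pos hb]
    exact mul_le_mul_of_nonneg_right (abs_le.2 ⟨hv.le, hv'.le⟩) hb.le
  have h3 : 3 / 4 * |a| ≤ |u * a| := by
    rw [abs_mul, abs_of_pos (by linarith : 0 < u)]
    exact mul_le_mul_of_nonneg_right hu.le (abs_nonneg a)
  have h4 : 3 / 4 * b ≤ u * b := mul_le_mul_of_nonneg_right hu.le hb.le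
  have h5 : |u * a| - |v * b| ≤ |u * a - v * b| := abs_sub_abs_le_abs_sub _ _
  have h6 := neg_abs_le (v * a)
  rcases abs_cases (u * b + v * a) with ⟨h7, h8⟩ | ⟨h7, h8⟩ <;> rw [h7] at h <;> linarith

theorem abs_add_abs_gt (hx : 10 < ‖x‖) :
    100 < |x.re ^ 2 - x.im ^ 2| + |2 * x.re * x.im| := by
  have h1 : ‖x ^ 2‖ ≤ |(x ^ 2).re| + |(x ^ 2).im| := Complex.norm_le_abs_re_add_abs_im _
  have h2 := re_im_mul_sq 1 x
  simp only [one_mul, Complex.one_re, Complex.one_im, zero_mul, sub_zero, add_zero] at h2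
  rw [h2.1, h2.2, norm_pow] at h1
  nlinarith

theorem one_lt_im_of_mul_pos (hc : ‖c - 1‖ < 1 / 4) (hx : 10 < ‖x‖)
    (h : |(c * x ^ 2).re| < 1 + |(c * x ^ 2).im|) (hpos : 0 < x.re * x.im) :
    1 < (c * x ^ 2).im := by
  obtain ⟨h1, h2, h3, h4⟩ := re_im_bounds hc
  rw [(re_im_mul_sq c x).1, (re_im_mul_sq c x).2] at h
  rw [(re_im_mul_sq c x).2]
  exact one_lt_of_abs_lt h1 h3 h4 (abs_add_abs_gt hx) (by linarith) h

theorem im_lt_of_mul_neg (hc : ‖c - 1‖ < 1 / 4) (hx : 10 < ‖x‖)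
    (h : |(c * x ^ 2).re| < 1 + |(c * x ^ 2).im|) (hneg : x.re * x.im < 0) :
    (c * x ^ 2).im < -1 := by
  obtain ⟨h1, h2, h3, h4⟩ := re_im_bounds hc
  rw [(re_im_mul_sq c x).1, (re_im_mul_sq c x).2] at h
  rw [(re_im_mul_sq c x).2]
  have h5 := abs_add_abs_gt hx
  rw [← abs_neg (2 * x.re * x.im)] at h5
  have := one_lt_of_abs_lt (v := -c.im) h1 (by linarith) (by linarith) h5 (by linarith) (by
    rw [← abs_neg (_ + _)] at h
    convert h using 2 <;> ring_nf)
  linarith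

theorem stripIndex_mul_sq (hT : ∀ k, ‖T k‖ < 1) (hc : ‖c - 1‖ < 1 / 4) (hx : 10 < ‖x‖)
    (h : c * x ^ 2 ∈ cutPlane T 1) (h' : c * x ^ 2 ∈ cutPlane T (-1)) :
    (stripIndex T (c * x ^ 2) = 0 ∧ (x.re < 0 ↔ 0 < x.im)) ∨
      (stripIndex T (c * x ^ 2) = n ∧ (x.re < 0 ↔ ¬ 0 < x.im)) := by
  have hlt : ∀ k, -1 < (T k).im ∧ (T k).im < 1 := fun k =>
    abs_lt.1 ((Complex.abs_im_le_norm _).trans_lt (hT k))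
  have hre := re_ne_zero_of_mem_cutPlane hc hx h
  have him := im_ne_zero_of_mem_cutPlane hc hx h'
  have hab := abs_re_lt_of_mem_cutPlane h h'
  rcases (mul_ne_zero hre him).lt_or_gt with hneg | hpos
  · refine .inl ⟨stripIndex_eq_zero fun k => ?_, ?_⟩
    · linarith [im_lt_of_mul_neg hc hx hab hneg, (hlt k).1]
    · rcases mul_neg_iff.1 hneg with h | h
      · exact iff_of_false h.1.not_gt h.2.not_gt
      · exact iff_of_true h.1 h.2
  · refine .inr ⟨stripIndex_eq_self fun k => ?_, ?_⟩
    · linarith [one_lt_im_of_mul_pos hc hx hab hpos, (hlt k).2]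
    · rcases mul_pos_iff.1 hpos with h | h
      · exact iff_of_false h.1.not_gt (not_not.2 h.2)
      · exact iff_of_true h.1 h.2.not_gt

end doubleCover

/-- The bidisc-like domain of the chart at infinity. -/
def chartNhds : Set (ℂ × ℂ) := {q | ‖q.1 * q.2‖ < 1 / 4 ∧ ‖q.2‖ < 1 / 10}

theorem isOpen_chartNhds : IsOpen chartNhds := by
  have h₁ : IsOpen {q : ℂ × ℂ | ‖q.1 * q.2‖ < 1 / 4} := isOpen_lt (by fun_prop) continuous_const
  have h₂ : IsOpen {q : ℂ × ℂ | ‖q.2‖ < 1 / 10} := isOpen_lt (by fun_prop) continuous_const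
  exact h₁.inter h₂

theorem contractibleSpace_chartNhds : ContractibleSpace chartNhds := by
  refine contractibleSpace_of_segment_subset (K := {0}) (fun _ => 0) continuous_const ?_
    (fun _ _ => rfl) (convex_singleton _) (by rintro _ rfl; simp [chartNhds])
    ⟨0, by simp [chartNhds]⟩
  rintro ⟨y, z⟩ ⟨h1, h2⟩ _ ⟨a, b, ha, hb, hab, rfl⟩
  have ha' : ‖(a : ℂ)‖ ≤ 1 := by
    rw [Complex.norm_real, Real.norm_of_nonneg ha]
    linarith
  simp only [smul_zero, add_zero, Prod.smul_mk, Complex.real_smul, chartNhds, mem_ofPred_eq]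
  constructor
  · refine lt_of_le_of_lt ?_ h1
    rw [show (a : ℂ) * y * (a * z) = a * a * (y * z) by ring, norm_mul, norm_mul]
    exact mul_le_of_le_one_left (norm_nonneg _) (mul_le_one₀ ha' (norm_nonneg _) ha')
  · refine lt_of_le_of_lt ?_ h2
    rw [norm_mul]
    exact mul_le_of_le_one_left (norm_nonneg _) ha'

theorem isPathConnected_chartNhds_diff :
    IsPathConnected {q : ℂ × ℂ | q ∈ chartNhds ∧ q.2 ≠ 0} := by
  have hconv : Convex ℝ (Metric.ball (0 : ℂ) (1 / 4) ×ˢ {ζ : ℂ | ζ.re < Real.log (1 / 10)}) :=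
    (convex_ball _ _).prod (convex_halfSpace_re_lt _)
  have hne : (Metric.ball (0 : ℂ) (1 / 4) ×ˢ {ζ : ℂ | ζ.re < Real.log (1 / 10)}).Nonempty :=
    ⟨(0, ((Real.log (1 / 10) - 1 : ℝ) : ℂ)), by simp, by
      rw [mem_ofPred_eq, Complex.ofReal_re]
      linarith⟩
  have hcont : Continuous fun q : ℂ × ℂ => (q.1 * Complex.exp (-q.2), Complex.exp q.2) := by
    fun_prop
  convert (hconv.isPathConnected hne).image hcont using 1
  ext ⟨y, z⟩
  simp only [mem_ofPred_eq, chartNhds, mem_image, Prod.exists, Prod.mk.injEq, mem_prod,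
    Metric.mem_ball, dist_zero_right]
  constructor
  · rintro ⟨⟨h1, h2⟩, hz⟩
    refine ⟨y * z, Complex.log z, ⟨h1, ?_⟩, ?_, Complex.exp_log hz⟩
    · rw [Complex.log_re]
      exact Real.log_lt_log (norm_pos_iff.2 hz) h2
    · rw [Complex.exp_neg, Complex.exp_log hz, mul_assoc, mul_inv_cancel₀ hz, mul_one]
  · rintro ⟨u, ζ, ⟨h1, h2⟩, rfl, rfl⟩
    refine ⟨⟨?_, ?_⟩, Complex.exp_ne_zero _⟩
    · rwa [mul_assoc, ← Complex.exp_add, neg_add_cancel, Complex.exp_zero, mul_one]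
    · rw [Complex.norm_exp, ← Real.lt_log_iff_exp_lt (by norm_num)]
      exact h2

section square

variable {n : ℕ} {T : Fin n → ℂ}

theorem sq_mem_cutPlane (hT : ∀ k, ‖T k‖ < 1) {s : ℝ} (hs : s * s = 1) {v : ℂ}
    (hv : v ^ 2 = s * 400) {u : ℝ} (hu : u ∈ Icc (-1 : ℝ) 1) :
    (v * (1 + u * Complex.I)) ^ 2 ∈ cutPlane T s := by
  have e : (v * (1 + u * Complex.I)) ^ 2 =
      ⟨s * (400 * (1 - u ^ 2)), s * (800 * u)⟩ := by
    rw [mul_pow, hv]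
    apply Complex.ext <;> simp [pow_two] <;> ring
  have e' : s * (s * (400 * (1 - u ^ 2))) = 400 * (1 - u ^ 2) := by
    linear_combination 400 * (1 - u ^ 2) * hs
  rw [e]
  refine ⟨fun k hk => ?_, ?_⟩
  · simp only at hk ⊢
    rw [e']
    have h1 : |800 * u| < 1 := by
      rw [← one_mul |800 * u|, ← abs_eq_one_of_mul_self hs, ← abs_mul, hk,
        abs_eq_one_of_mul_self hs]
      exact (Complex.abs_im_le_norm _).trans_lt (hT k)
    have h2 : s * (T k).re < 1 := calc
      s * (T k).re ≤ |s * (T k).re| := le_abs_self _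
      _ = |(T k).re| := by rw [abs_mul, abs_eq_one_of_mul_self hs, one_mul]
      _ ≤ ‖T k‖ := Complex.abs_re_le_norm _
      _ < 1 := hT k
    have h3 := abs_lt.1 h1
    nlinarith
  · simp only
    rw [e']
    nlinarith [hu.1, hu.2, abs_nonneg (s * (800 * u))]

theorem ten_lt_norm {v : ℂ} (hv : ‖v‖ = 20) (u : ℝ) : 10 < ‖v * (1 + u * Complex.I)‖ := by
  have h := Complex.abs_re_le_norm (1 + u * Complex.I)
  simp only [Complex.add_re, Complex.one_re, Complex.re_ofReal_mul, Complex.I_re, mul_zero,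
    add_zero, abs_one] at h
  rw [norm_mul, hv]
  linarith

end square

section charts

variable {X : Type*} [TopologicalSpace X] {n : ℕ} {T : Fin n → ℂ}
  {e f : OpenPartialHomeomorph X (ℂ × ℂ)}

theorem square_mem
    (hf : f.target = chartNhds) (htr : ∀ p ∈ f.source, (p ∈ e.source ↔ (f p).2 ≠ 0))
    (htr' : ∀ p ∈ f.source, (f p).2 ≠ 0 →
      e p = ((f p).2⁻¹, (1 - (f p).1 * (f p).2) * (f p).2⁻¹ ^ 2)) {x : ℂ} (hx : 10 < ‖x‖) :
    ((0, x⁻¹) : ℂ × ℂ) ∈ f.target ∧ f.symm (0, x⁻¹) ∈ f.source ∧ f.symm (0, x⁻¹) ∈ e.source ∧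
      e (f.symm (0, x⁻¹)) = (x, x ^ 2) := by
  have hx0 : x ≠ 0 := by
    rintro rfl
    simp at hx
    linarith
  have ht : ((0, x⁻¹) : ℂ × ℂ) ∈ f.target := by
    rw [hf]
    refine ⟨by simp, ?_⟩
    simp only [norm_inv]
    rw [inv_lt_comm₀ (by linarith) (by norm_num)]
    norm_num [hx]
  have hs := f.map_target ht
  have hr := f.right_inv ht
  have hz : (f (f.symm (0, x⁻¹))).2 ≠ 0 := by
    rw [hr]
    exact inv_ne_zero hx0
  refine ⟨ht, hs, (htr _ hs).2 hz, ?_⟩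
  rw [htr' _ hs hz, hr]
  simp

/-- A space covered by the two standard charts of the complement of a pencil of hyperosculating
conics has a cover by strips. -/
theorem nonempty_stripCover_of_charts (hT : ∀ k, ‖T k‖ < 1)
    (hmono : StrictMono fun k => (T k).im) (he : e.target = {q | ∀ k, q.2 ≠ T k})
    (hf : f.target = chartNhds) (hcov : ∀ p, p ∈ e.source ∨ p ∈ f.source)
    (htr : ∀ p ∈ f.source, (p ∈ e.source ↔ (f p).2 ≠ 0))
    (htr' : ∀ p ∈ f.source, (f p).2 ≠ 0 →
      e p = ((f p).2⁻¹, (1 - (f p).1 * (f p).2) * (f p).2⁻¹ ^ 2)) :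
    Nonempty (StripCover X n) := by
  have hsub : ∀ s : ℝ, (univ : Set ℂ) ×ˢ cutPlane T s ⊆ e.target := by
    rintro s ⟨x, t⟩ ⟨-, ht⟩
    rw [he]
    exact fun k => ne_of_mem_cutPlane ht k
  have hAo : ∀ s : ℝ, IsOpen (e.source ∩ e ⁻¹' (univ ×ˢ cutPlane T s)) := fun s =>
    e.isOpen_inter_preimage (isOpen_univ.prod isOpen_cutPlane)
  have hA : ∀ s : ℝ, s * s = 1 →
      IsSimplyConnected (e.source ∩ e ⁻¹' (univ ×ˢ cutPlane T s)) := fun s hs =>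
    e.isSimplyConnected_inter_preimage (hsub s) (contractibleSpace_univ_prod_cutPlane hT hs)
  have hmem : ∀ p, p ∈ e.source ↔ p ∈ e.source ∩ e ⁻¹' (univ ×ˢ cutPlane T 1) ∨
      p ∈ e.source ∩ e ⁻¹' (univ ×ˢ cutPlane T (-1)) := fun p => by
    refine ⟨fun h => ?_, fun h => h.elim And.left And.left⟩
    have h' := e.map_source h
    rw [he] at h'
    exact (mem_cutPlane_or hT hmono.injective h').imp (fun h1 => ⟨h, mem_univ _, h1⟩)
      fun h1 => ⟨h, mem_univ _, h1⟩
  have hev : ∀ p ∈ e.source, ∀ P : ℂ × ℂ → Prop, (∀ᶠ q in 𝓝 (e p), P q) →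
      ∀ᶠ p' in 𝓝 p, P (e p') := fun p hp P hP => (e.continuousAt hp).eventually hP
  have hform : ∀ p ∈ f.source, p ∈ e.source → ∃ c x : ℂ, ‖c - 1‖ < 1 / 4 ∧ 10 < ‖x‖ ∧
      e p = (x, c * x ^ 2) := fun p hp hpe => by
    have hz := (htr p hp).1 hpe
    have h := f.map_source hp
    rw [hf] at h
    refine ⟨1 - (f p).1 * (f p).2, (f p).2⁻¹, ?_, ?_, htr' p hp hz⟩
    · rw [sub_sub_cancel_left, norm_neg]
      exact h.1
    · rw [norm_inv, lt_inv_comm₀ (by norm_num) (norm_pos_iff.2 hz)]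
      simpa using h.2
  have hsq := fun {x : ℂ} => square_mem (x := x) hf htr htr'
  have hjoin : ∀ s : ℝ, s * s = 1 → ∀ v : ℂ, v ^ 2 = s * 400 → ‖v‖ = 20 →
      ∀ u ∈ Icc (-1 : ℝ) 1, ∀ u' ∈ Icc (-1 : ℝ) 1,
      JoinedIn (e.source ∩ e ⁻¹' (univ ×ˢ cutPlane T s) ∩ f.source)
        (f.symm (0, (v * (1 + u * Complex.I))⁻¹)) (f.symm (0, (v * (1 + u' * Complex.I))⁻¹)) := by
    intro s hs v hv hv' u hu u' hu'
    have hpc := ((convex_Icc (-1 : ℝ) 1).isPathConnected ⟨u, hu⟩).image'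
      (f := fun u : ℝ => f.symm (0, (v * (1 + u * Complex.I))⁻¹)) ?_
    · refine (hpc.joinedIn _ ⟨u, hu, rfl⟩ _ ⟨u', hu', rfl⟩).mono ?_
      rintro _ ⟨w, hw, rfl⟩
      obtain ⟨-, h1, h2, h3⟩ := hsq (ten_lt_norm hv' w)
      refine ⟨⟨h2, ?_⟩, h1⟩
      rw [mem_preimage, h3]
      exact ⟨mem_univ _, sq_mem_cutPlane hT hs hv hw⟩
    · refine f.continuousOn_symm.comp (t := f.target) ?_ ?_
      · refine continuousOn_const.prodMk (ContinuousOn.inv₀ (by fun_prop) fun w _ h0 => ?_)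
        have := ten_lt_norm hv' w
        rw [h0, norm_zero] at this
        linarith
      · exact fun w _ => (hsq (ten_lt_norm hv' w)).1
  have hcorner : ∀ v : ℂ, ‖v‖ = 20 → ∀ r : ℝ, r * r = 1 → ∀ σ : ℝ, v ^ 2 = σ * 400 → σ * σ = 1 →
      ((f.symm (0, (v * (1 + r * Complex.I))⁻¹) ∈ e.source ∩ e ⁻¹' (univ ×ˢ cutPlane T 1) ∧
        f.symm (0, (v * (1 + r * Complex.I))⁻¹) ∈ e.source ∩ e ⁻¹' (univ ×ˢ cutPlane T (-1))) ∧
      stripIndex T (e (f.symm (0, (v * (1 + r * Complex.I))⁻¹))).2 =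
        if 0 < σ * r then n else 0) := by
    intro v hv r hr σ hσ hσ'
    obtain ⟨-, h1, h2, h3⟩ := hsq (ten_lt_norm hv r)
    have h4 : (v * (1 + r * Complex.I)) ^ 2 = ⟨0, 800 * (σ * r)⟩ := by
      rw [mul_pow, hσ]
      apply Complex.ext <;> simp [pow_two, hr]
      ring
    have hlt : ∀ k, -1 < (T k).im ∧ (T k).im < 1 := fun k =>
      abs_lt.1 ((Complex.abs_im_le_norm _).trans_lt (hT k))
    have h5 : σ * r = 1 ∨ σ * r = -1 := mul_self_eq_one_iff.1 (by
      linear_combination r * r * hσ' + hr)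
    simp only [mem_inter_iff, mem_preimage, mem_prod, mem_univ, true_and, h2, h3, h4]
    rcases h5 with h5 | h5 <;> rw [h5]
    · refine ⟨mem_cutPlane_inter (fun k => ?_) (by norm_num), ?_⟩
      · simp only
        linarith [(hlt k).2]
      · rw [if_pos one_pos]
        exact stripIndex_eq_self fun k => by simp only; linarith [(hlt k).2]
    · refine ⟨mem_cutPlane_inter (fun k => ?_) (by norm_num), ?_⟩
      · simp only
        linarith [(hlt k).1]
      · rw [if_neg (by norm_num)]
        exact stripIndex_eq_zero fun k => by simp only; linarith [(hlt k).1]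
  refine ⟨{
    A := e.source ∩ e ⁻¹' (univ ×ˢ cutPlane T 1)
    B := e.source ∩ e ⁻¹' (univ ×ˢ cutPlane T (-1))
    V := f.source
    strip := fun p => stripIndex T (e p).2
    sheetA := fun p => (e p).1.re < 0
    sheetB := fun p => 0 < (e p).1.im
    isOpen_A := hAo 1
    isOpen_B := hAo (-1)
    isOpen_V := f.open_source
    isSimplyConnected_A := hA 1 (by norm_num)
    isSimplyConnected_B := hA (-1) (by norm_num)
    isSimplyConnected_V := ?_
    cover := fun p => by
      rw [← or_assoc, ← hmem]
      exact hcov p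
    strip_eventually_eq := ?_
    strip_le := fun _ _ _ => stripIndex_le
    isPathConnected_strip := ?_
    isPathConnected_inter := ?_
    sheetA_eventually_iff := ?_
    sheetB_eventually_iff := ?_
    sheet_iff := ?_
    exists_square := ?_ }⟩
  · have := f.isSimplyConnected_inter_preimage hf.ge contractibleSpace_chartNhds
    have h : f.source ∩ f ⁻¹' f.target = f.source := inter_eq_left.2 f.mapsTo
    rwa [← hf, h] at this
  · intro p hp hp'
    exact hev p hp.1 (fun q => stripIndex T q.2 = stripIndex T (e p).2)
      (continuous_snd.continuousAt.eventually
        (stripIndex_eventually_eq (im_ne_of_mem_cutPlane hp.2.2 hp'.2.2)))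
  · intro k hk
    convert e.isPathConnected_inter_preimage ?_ (isPathConnected_strip hmono hk) using 1
    · ext p
      simp only [mem_inter_iff, mem_preimage, mem_prod, mem_univ, true_and, mem_ofPred_eq]
      tauto
    · exact fun q hq => hsub 1 ⟨mem_univ _, hq.1.1⟩
  · convert f.isPathConnected_inter_preimage ?_ isPathConnected_chartNhds_diff using 1
    · ext p
      rw [mem_inter_iff, mem_union, ← hmem]
      refine and_congr_right fun hp => ?_
      have h := f.map_source hp
      rw [hf] at h
      rw [htr p hp]
      exact ⟨fun h' => ⟨h, h'⟩, And.right⟩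
    · rw [hf]
      exact fun q hq => hq.1
  · intro p hp hp'
    obtain ⟨c, x, hc, hx, hex⟩ := hform p hp hp'.1
    have h := hp'.2.2
    rw [hex] at h
    have h0 := re_ne_zero_of_mem_cutPlane hc hx h
    refine hev p hp'.1 (fun q => (q.1.re < 0 ↔ (e p).1.re < 0)) ?_
    rw [hex]
    rcases h0.lt_or_gt with h0 | h0
    · filter_upwards [(isOpen_lt (Complex.continuous_re.comp continuous_fst)
        continuous_const).mem_nhds h0] with q hq
      exact iff_of_true hq h0
    · filter_upwards [(isOpen_lt continuous_const
        (Complex.continuous_re.comp continuous_fst)).mem_nhds h0] with q hq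
      exact iff_of_false (lt_asymm hq) h0.not_gt
  · intro p hp hp'
    obtain ⟨c, x, hc, hx, hex⟩ := hform p hp hp'.1
    have h := hp'.2.2
    rw [hex] at h
    have h0 := im_ne_zero_of_mem_cutPlane hc hx h
    refine hev p hp'.1 (fun q => (0 < q.1.im ↔ 0 < (e p).1.im)) ?_
    rw [hex]
    rcases h0.lt_or_gt with h0 | h0
    · filter_upwards [(isOpen_lt (Complex.continuous_im.comp continuous_fst)
        continuous_const).mem_nhds h0] with q hq
      exact iff_of_false (lt_asymm hq) h0.not_gt
    · filter_upwards [(isOpen_lt continuous_const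
        (Complex.continuous_im.comp continuous_fst)).mem_nhds h0] with q hq
      exact iff_of_true hq h0
  · intro p hp hp' hp''
    obtain ⟨c, x, hc, hx, hex⟩ := hform p hp hp'.1
    have h := hp'.2.2
    have h' := hp''.2.2
    rw [hex] at h h'
    rw [hex]
    exact stripIndex_mul_sq hT hc hx h h'
  · have h1 : (1 : ℝ) ∈ Icc (-1 : ℝ) 1 := by norm_num
    have h2 : (-1 : ℝ) ∈ Icc (-1 : ℝ) 1 := by norm_num
    have n1 : ‖(20 : ℂ)‖ = 20 := by norm_num
    have n2 : ‖20 * Complex.I‖ = 20 := by simp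
    have n3 : ‖(-20 : ℂ)‖ = 20 := by simp
    have n4 : ‖-20 * Complex.I‖ = 20 := by simp
    have q1 : (20 : ℂ) ^ 2 = (1 : ℝ) * 400 := by norm_num
    have q2 : (20 * Complex.I) ^ 2 = (-1 : ℝ) * 400 := by
      rw [mul_pow, Complex.I_sq]
      norm_num
    have q3 : (-20 : ℂ) ^ 2 = (1 : ℝ) * 400 := by norm_num
    have q4 : (-20 * Complex.I) ^ 2 = (-1 : ℝ) * 400 := by
      rw [mul_pow, Complex.I_sq]
      norm_num
    have e2 : (20 : ℂ) * (1 + (1 : ℝ) * Complex.I) =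
        20 * Complex.I * (1 + (-1 : ℝ) * Complex.I) := by
      apply Complex.ext <;> simp
    have e3 : 20 * Complex.I * (1 + (1 : ℝ) * Complex.I) = -20 * (1 + (-1 : ℝ) * Complex.I) := by
      apply Complex.ext <;> simp
    have e4 : -20 * (1 + (1 : ℝ) * Complex.I) = -20 * Complex.I * (1 + (-1 : ℝ) * Complex.I) := by
      apply Complex.ext <;> simp
    have e1 : -20 * Complex.I * (1 + (1 : ℝ) * Complex.I) = 20 * (1 + (-1 : ℝ) * Complex.I) := by
      apply Complex.ext <;> simp
    have j1 := hjoin 1 (by norm_num) _ q1 n1 _ h2 _ h1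
    have j2 := hjoin (-1) (by norm_num) _ q2 n2 _ h2 _ h1
    have j3 := hjoin 1 (by norm_num) _ q3 n3 _ h2 _ h1
    have j4 := hjoin (-1) (by norm_num) _ q4 n4 _ h2 _ h1
    rw [← e2] at j2
    rw [← e3] at j3
    rw [← e4, e1] at j4
    refine ⟨_, _, _, _, ?_, ?_, ?_, ?_, j1, j2, j3, j4⟩
    · have := hcorner _ n1 (-1) (by norm_num) 1 q1 (by norm_num)
      rwa [if_neg (by norm_num)] at this
    · simpa using hcorner _ n1 1 (by norm_num) 1 q1 (by norm_num)
    · have := hcorner _ n2 1 (by norm_num) (-1) q2 (by norm_num)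
      rwa [if_neg (by norm_num)] at this
    · simpa using hcorner _ n3 1 (by norm_num) 1 q3 (by norm_num)

end charts

section affineChart

variable (g : (Fin 3 → ℂ) ≃L[ℂ] (Fin 3 → ℂ))

/-- The point of the projective plane with homogeneous coordinates `v` in the frame `g`. -/
def frameMk (v : {v : Fin 3 → ℂ // v ≠ 0}) : P2 :=
  Projectivization.mk ℂ (g v) ((map_ne_zero_iff g g.injective).2 v.2)

theorem continuous_frameMk : Continuous (frameMk g) :=
  continuous_quot_mk.comp
    ((g.continuous.comp continuous_subtype_val).subtype_mk
      fun v => (map_ne_zero_iff g g.injective).2 v.2)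

theorem isQuotientMap_frameMk : IsQuotientMap (frameMk g) := by
  let h : {v : Fin 3 → ℂ // v ≠ 0} ≃ₜ {v : Fin 3 → ℂ // v ≠ 0} :=
    g.toHomeomorph.subtype fun v => (map_ne_zero_iff g g.injective).symm
  exact isQuotientMap_quot_mk.comp h.isQuotientMap

theorem frameMk_surjective : Function.Surjective (frameMk g) := (isQuotientMap_frameMk g).surjective

theorem frameMk_eq_iff {v w : {v : Fin 3 → ℂ // v ≠ 0}} :
    frameMk g v = frameMk g w ↔ ∃ a : ℂ, a • (w : Fin 3 → ℂ) = v := by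
  rw [frameMk, frameMk, Projectivization.mk_eq_mk_iff']
  simp only [← map_smul, g.injective.eq_iff]

/-- The homogeneous coordinates of a point in the frame `g`. -/
def frameRep (p : P2) : Fin 3 → ℂ := g.symm p.rep

theorem exists_frameRep_frameMk (v : {v : Fin 3 → ℂ // v ≠ 0}) :
    ∃ a : ℂ, a ≠ 0 ∧ frameRep g (frameMk g v) = a • (v : Fin 3 → ℂ) := by
  obtain ⟨a, ha⟩ := Projectivization.exists_smul_eq_mk_rep ℂ (g v)
    ((map_ne_zero_iff g g.injective).2 v.2)
  refine ⟨a, a.ne_zero, ?_⟩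
  rw [frameRep, frameMk, ← ha, Units.smul_def, map_smul, g.symm_apply_apply]

theorem vec_ne_zero (q : ℂ × ℂ) : ![q.1, q.2, 1] ≠ 0 := fun h => by
  simpa using congrFun h 2

theorem isOpen_frameRep_ne_zero : IsOpen {p | frameRep g p 2 ≠ 0} := by
  rw [← (isQuotientMap_frameMk g).isOpen_preimage]
  convert (isOpen_ne_fun ((continuous_apply 2).comp continuous_subtype_val)
    continuous_const : IsOpen {v : {v : Fin 3 → ℂ // v ≠ 0} | v.1 2 ≠ 0}) using 1
  ext v
  obtain ⟨a, ha, h⟩ := exists_frameRep_frameMk g v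
  simp [h, ha]

/-- The affine chart of the projective plane given by the frame `g`. -/
def affineChart : OpenPartialHomeomorph P2 (ℂ × ℂ) where
  toFun p := (frameRep g p 0 / frameRep g p 2, frameRep g p 1 / frameRep g p 2)
  invFun q := frameMk g ⟨![q.1, q.2, 1], vec_ne_zero q⟩
  source := {p | frameRep g p 2 ≠ 0}
  target := univ
  map_source' _ _ := mem_univ _
  map_target' q _ := by
    obtain ⟨a, ha, h⟩ := exists_frameRep_frameMk g ⟨![q.1, q.2, 1], vec_ne_zero q⟩
    rw [mem_ofPred_eq, h]
    simpa using ha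
  left_inv' p hp := by
    obtain ⟨v, rfl⟩ := frameMk_surjective g p
    obtain ⟨a, ha, h⟩ := exists_frameRep_frameMk g v
    rw [mem_ofPred_eq, h] at hp
    rw [frameMk_eq_iff, h]
    have hv : v.1 2 ≠ 0 := fun h0 => hp (by simp [h0])
    refine ⟨(v.1 2)⁻¹, funext fun i => ?_⟩
    fin_cases i <;> simp [hv] <;> field_simp
  right_inv' q _ := by
    obtain ⟨a, ha, h⟩ := exists_frameRep_frameMk g ⟨![q.1, q.2, 1], vec_ne_zero q⟩
    rw [h]
    simp [ha]
  open_source := isOpen_frameRep_ne_zero g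
  open_target := isOpen_univ
  continuousOn_toFun := by
    rw [(isQuotientMap_frameMk g).continuousOn_isOpen_iff (isOpen_frameRep_ne_zero g)]
    have h2 : ∀ v : {v : Fin 3 → ℂ // v ≠ 0},
        v ∈ frameMk g ⁻¹' {p | frameRep g p 2 ≠ 0} → v.1 2 ≠ 0 := fun v hv h0 => by
      obtain ⟨a, ha, h⟩ := exists_frameRep_frameMk g v
      rw [mem_preimage, mem_ofPred_eq, h] at hv
      exact hv (by simp [h0])
    have hc : ∀ i, Continuous fun v : {v : Fin 3 → ℂ // v ≠ 0} => v.1 i := fun i =>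
      (continuous_apply i).comp continuous_subtype_val
    refine ContinuousOn.congr (f := fun v => (v.1 0 / v.1 2, v.1 1 / v.1 2)) ?_ fun v hv => ?_
    · exact (ContinuousOn.div (hc _).continuousOn (hc _).continuousOn h2).prodMk
        (ContinuousOn.div (hc _).continuousOn (hc _).continuousOn h2)
    · obtain ⟨a, ha, h⟩ := exists_frameRep_frameMk g v
      simp [h, mul_div_mul_left, ha]
  continuousOn_invFun := by
    refine Continuous.continuousOn ((continuous_frameMk g).comp (Continuous.subtype_mk ?_ _))
    fun_prop

variable {g}

theorem frameMk_mem_affineChart_source {v : {v : Fin 3 → ℂ // v ≠ 0}} :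
    frameMk g v ∈ (affineChart g).source ↔ v.1 2 ≠ 0 := by
  obtain ⟨a, ha, h⟩ := exists_frameRep_frameMk g v
  simp [affineChart, h, ha]

theorem affineChart_frameMk (v : {v : Fin 3 → ℂ // v ≠ 0}) :
    affineChart g (frameMk g v) = (v.1 0 / v.1 2, v.1 1 / v.1 2) := by
  obtain ⟨a, ha, h⟩ := exists_frameRep_frameMk g v
  change (_ / _, _ / _) = _
  rw [h]
  simp [mul_div_mul_left, ha]

end affineChart

section complement

variable {n : ℕ} {T : Fin n → ℂ} {S : Set P2} {g : (Fin 3 → ℂ) ≃L[ℂ] (Fin 3 → ℂ)}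

/-- The shear straightening the pencil of parabolas `t = x² - y`. -/
def shear : (ℂ × ℂ) ≃ₜ (ℂ × ℂ) where
  toFun q := (q.1, q.1 ^ 2 - q.2)
  invFun q := (q.1, q.1 ^ 2 - q.2)
  left_inv q := by simp
  right_inv q := by simp
  continuous_toFun := by fun_prop
  continuous_invFun := by fun_prop

variable (g) in
/-- The frame `g` with its coordinates cyclically permuted. -/
def rotateFrame : (Fin 3 → ℂ) ≃L[ℂ] (Fin 3 → ℂ) :=
  ((LinearEquiv.funCongrLeft ℂ ℂ (finRotate 3).symm).toContinuousLinearEquiv).trans g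

theorem rotateFrame_apply (v : Fin 3 → ℂ) : rotateFrame g v = g ![v 2, v 0, v 1] := by
  rw [rotateFrame, ContinuousLinearEquiv.trans_apply]
  congr 1
  ext i
  fin_cases i <;> rfl

theorem isOpen_of_frame (hS : ∀ v, frameMk g v ∈ S ↔
    ∀ k, v.1 0 ^ 2 - v.1 1 * v.1 2 ≠ T k * v.1 2 ^ 2) : IsOpen S := by
  rw [← (isQuotientMap_frameMk g).isOpen_preimage]
  have hc : ∀ i, Continuous fun v : {v : Fin 3 → ℂ // v ≠ 0} => v.1 i := fun i =>
    (continuous_apply i).comp continuous_subtype_val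
  have : frameMk g ⁻¹' S = ⋂ k, {v | v.1 0 ^ 2 - v.1 1 * v.1 2 ≠ T k * v.1 2 ^ 2} := by
    ext v
    simp [hS]
  rw [this]
  exact isOpen_iInter_of_finite fun k => isOpen_ne_fun
    (((hc 0).pow 2).sub ((hc 1).mul (hc 2))) (continuous_const.mul ((hc 2).pow 2))

/-- The complement of a pencil of hyperosculating conics in normal form. -/
theorem nonempty_mulEquiv_of_frame (hn : 1 ≤ n) (hT : ∀ k, ‖T k‖ < 1)
    (hmono : StrictMono fun k => (T k).im) (hS : ∀ v, frameMk g v ∈ S ↔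
      ∀ k, v.1 0 ^ 2 - v.1 1 * v.1 2 ≠ T k * v.1 2 ^ 2) (x : S) :
    Nonempty (FundamentalGroup S x ≃* PresentedGroup (relAn n)) := by
  let U : TopologicalSpace.Opens P2 := ⟨S, isOpen_of_frame hS⟩
  have hU : Nonempty U := ⟨x⟩
  let e₀ := (affineChart g).trans shear.toOpenPartialHomeomorph
  let f₀ := (affineChart (rotateFrame g)).trans (.ofSet chartNhds isOpen_chartNhds)
  let e : OpenPartialHomeomorph U (ℂ × ℂ) := e₀.subtypeRestr hU
  let f : OpenPartialHomeomorph U (ℂ × ℂ) := f₀.subtypeRestr hU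
  have rot : ∀ w : {v : Fin 3 → ℂ // v ≠ 0}, ∃ v : {v : Fin 3 → ℂ // v ≠ 0},
      frameMk (rotateFrame g) w = frameMk g v ∧ v.1 = ![w.1 2, w.1 0, w.1 1] := fun w =>
    ⟨⟨![w.1 2, w.1 0, w.1 1], fun h => w.2 (by
      ext i
      fin_cases i
      exacts [congrFun h 1, congrFun h 2, congrFun h 0])⟩, by
      simp only [frameMk, rotateFrame_apply], rfl⟩
  have rot' : ∀ v : {v : Fin 3 → ℂ // v ≠ 0}, ∃ w : {v : Fin 3 → ℂ // v ≠ 0},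
      frameMk g v = frameMk (rotateFrame g) w ∧ w.1 = ![v.1 1, v.1 2, v.1 0] := fun v =>
    ⟨⟨![v.1 1, v.1 2, v.1 0], fun h => v.2 (by
      ext i
      fin_cases i
      exacts [congrFun h 2, congrFun h 0, congrFun h 1])⟩, by
      simp only [frameMk, rotateFrame_apply]
      congr 2
      ext i
      fin_cases i <;> rfl, rfl⟩
  have hes : ∀ v, frameMk g v ∈ e₀.source ↔ v.1 2 ≠ 0 := fun v => by
    simp [e₀, frameMk_mem_affineChart_source]
  have hev : ∀ v, e₀ (frameMk g v) = (v.1 0 / v.1 2, (v.1 0 / v.1 2) ^ 2 - v.1 1 / v.1 2) :=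
    fun v => by
      simp [e₀, affineChart_frameMk, shear]
  have hfs : ∀ v, frameMk g v ∈ f₀.source ↔
      v.1 0 ≠ 0 ∧ (v.1 1 / v.1 0, v.1 2 / v.1 0) ∈ chartNhds := fun v => by
    obtain ⟨w, h, hw⟩ := rot' v
    simp [f₀, h, frameMk_mem_affineChart_source, affineChart_frameMk, hw]
  have hfv : ∀ v, f₀ (frameMk g v) = (v.1 1 / v.1 0, v.1 2 / v.1 0) := fun v => by
    obtain ⟨w, h, hw⟩ := rot' v
    simp [f₀, h, affineChart_frameMk, hw]
  have he : e.target = {q | ∀ k, q.2 ≠ T k} := by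
    ext q
    have : e₀.symm q = frameMk g ⟨![q.1, q.1 ^ 2 - q.2, 1], vec_ne_zero (q.1, q.1 ^ 2 - q.2)⟩ := rfl
    have h : q ∈ e₀.target := by simp [e₀, affineChart]
    simp [e, OpenPartialHomeomorph.subtypeRestr_def, this, U, h, hS]
  have hf : f.target = chartNhds := by
    ext q
    have : f₀.symm q = frameMk (rotateFrame g) ⟨![q.1, q.2, 1], vec_ne_zero q⟩ := rfl
    obtain ⟨v, h, hv⟩ := rot ⟨![q.1, q.2, 1], vec_ne_zero q⟩
    have h' : q ∈ f₀.target ↔ q ∈ chartNhds := by simp [f₀, affineChart]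
    simp [f, OpenPartialHomeomorph.subtypeRestr_def, this, h, U, hv, hS, h']
    intro h k hk
    have h₁ := h.1
    have h₂ := h.2
    have h₃ := norm_sub_norm_le 1 (q.1 * q.2)
    rw [norm_one, hk, norm_mul (T k), norm_pow] at h₃
    have h₄ := mul_le_mul_of_nonneg_right (hT k).le (sq_nonneg ‖q.2‖)
    nlinarith [norm_nonneg q.2]
  obtain ⟨C⟩ : Nonempty (StripCover U n) := by
    refine nonempty_stripCover_of_charts hT hmono he hf ?_ ?_ ?_
    · rintro ⟨p, hp⟩
      obtain ⟨v, rfl⟩ := frameMk_surjective g p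
      have hp' := (hS v).1 hp
      simp only [e, f, OpenPartialHomeomorph.subtypeRestr_source, mem_preimage, hes, hfs]
      refine or_iff_not_imp_left.2 fun h => ?_
      push Not at h
      refine ⟨fun h0 => hp' ⟨0, hn⟩ (by simp [h, h0]), ?_⟩
      simp [chartNhds, h]
    · rintro ⟨p, hp⟩ h
      obtain ⟨v, rfl⟩ := frameMk_surjective g p
      simp only [e, f, OpenPartialHomeomorph.subtypeRestr_source, mem_preimage, hes, hfs,
        OpenPartialHomeomorph.subtypeRestr_coe, domRestrict_apply, hfv] at h ⊢
      simp [h.1]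
    · rintro ⟨p, hp⟩ h
      obtain ⟨v, rfl⟩ := frameMk_surjective g p
      simp only [e, f, OpenPartialHomeomorph.subtypeRestr_source, mem_preimage, hfs,
        OpenPartialHomeomorph.subtypeRestr_coe, domRestrict_apply, hfv, hev] at h ⊢
      intro h'
      have h0 := h.1
      have h2 : v.1 2 ≠ 0 := fun h2 => h' (by simp [h2])
      refine Prod.ext ?_ ?_ <;> simp only <;> field_simp
  exact C.nonempty_mulEquiv x

end complement

section rescale

theorem exists_rescale {n : ℕ} {T : Fin n → ℂ} (hT : Function.Injective T) :
    ∃ u : ℂ, u ≠ 0 ∧ (∀ k, ‖u * T k‖ < 1) ∧ Function.Injective fun k => (u * T k).im := by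
  obtain ⟨s, hs⟩ := Infinite.exists_notMem_finset (Finset.univ.image fun k : Fin n × Fin n =>
    -((T k.1 - T k.2).im / (T k.1 - T k.2).re))
  simp only [Finset.mem_image, Finset.mem_univ, true_and, not_exists, Prod.forall] at hs
  set w : ℂ := 1 + s * Complex.I
  have hw : w ≠ 0 := fun h => by simpa [w] using congrArg Complex.re h
  have hinj : Function.Injective fun k => (w * T k).im := fun i j hij => by
    by_contra hne
    have h0 : (T i - T j).im + s * (T i - T j).re = 0 := by
      simp [w] at hij ⊢
      linarith
    by_cases hre : (T i - T j).re = 0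
    · rw [hre, mul_zero, add_zero] at h0
      exact hne (hT (sub_eq_zero.1 (Complex.ext hre h0)))
    · exact hs i j (by field_simp; linarith)
  set M : ℝ := 1 + ∑ k, ‖w * T k‖
  have hM : 0 < M := by positivity
  refine ⟨(M⁻¹ : ℝ) * w, mul_ne_zero (by exact_mod_cast inv_ne_zero hM.ne') hw, fun k => ?_,
    fun i j hij => ?_⟩
  · rw [mul_assoc, norm_mul, Complex.norm_real, Real.norm_of_nonneg (by positivity),
      inv_mul_lt_iff₀ hM, mul_one]
    have := Finset.single_le_sum (f := fun k => ‖w * T k‖) (fun _ _ => norm_nonneg _)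
      (Finset.mem_univ k)
    simp only [M] at this ⊢
    linarith
  · simp only [mul_assoc, Complex.im_ofReal_mul] at hij
    exact hinj (mul_left_cancel₀ (inv_ne_zero hM.ne') hij)

/-- The frame `g` with its last two coordinates rescaled by inverse factors. -/
def rescaleFrame (g : (Fin 3 → ℂ) ≃L[ℂ] (Fin 3 → ℂ)) (c : ℂˣ) : (Fin 3 → ℂ) ≃L[ℂ] (Fin 3 → ℂ) :=
  (LinearEquiv.piCongrRight fun i : Fin 3 =>
    LinearEquiv.smulOfUnit (![1, c⁻¹, c] i)).toContinuousLinearEquiv.trans g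

theorem rescaleFrame_apply (g : (Fin 3 → ℂ) ≃L[ℂ] (Fin 3 → ℂ)) (c : ℂˣ) (v : Fin 3 → ℂ) :
    rescaleFrame g c v = g ![v 0, (c : ℂ)⁻¹ * v 1, c * v 2] := by
  rw [rescaleFrame, ContinuousLinearEquiv.trans_apply]
  congr 1
  ext i
  fin_cases i <;> simp [LinearEquiv.smulOfUnit, Units.smul_def]

theorem nonempty_mulEquiv_of_injective {n : ℕ} {T : Fin n → ℂ} {S : Set P2}
    {g : (Fin 3 → ℂ) ≃L[ℂ] (Fin 3 → ℂ)} (hn : 1 ≤ n) (hT : Function.Injective T)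
    (hS : ∀ v, frameMk g v ∈ S ↔ ∀ k, v.1 0 ^ 2 - v.1 1 * v.1 2 ≠ T k * v.1 2 ^ 2) (x : S) :
    Nonempty (FundamentalGroup S x ≃* PresentedGroup (relAn n)) := by
  obtain ⟨u, hu, hlt, hinj⟩ := exists_rescale hT
  obtain ⟨c, hc⟩ := IsAlgClosed.exists_pow_nat_eq u two_pos
  have hc0 : c ≠ 0 := by
    rintro rfl
    exact hu (by simpa using hc.symm)
  have hmono : StrictMono ((fun k => (u * T k).im) ∘ Tuple.sort fun k => (u * T k).im) :=
    (Tuple.monotone_sort _).strictMono_of_injective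
      (hinj.comp (Tuple.sort fun k => (u * T k).im).injective)
  set σ := Tuple.sort fun k => (u * T k).im
  refine nonempty_mulEquiv_of_frame (T := fun k => u * T (σ k)) (g := rescaleFrame g (.mk0 c hc0))
    hn (fun k => hlt _) hmono (fun v => ?_) x
  have hv : ![v.1 0, c⁻¹ * v.1 1, c * v.1 2] ≠ 0 := fun h => v.2 (by
    ext i
    have h0 := congrFun h 0
    have h1 := congrFun h 1
    have h2 := congrFun h 2
    fin_cases i <;> simp_all)
  have e : frameMk (rescaleFrame g (.mk0 c hc0)) v = frameMk g ⟨_, hv⟩ := by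
    simp only [frameMk, rescaleFrame_apply, Units.val_mk0]
  rw [e, hS, ← σ.forall_congr_right]
  refine forall_congr' fun k => not_congr ?_
  simp only [Matrix.cons_val]
  rw [← hc]
  have : c⁻¹ * v.1 1 * (c * v.1 2) = v.1 1 * v.1 2 := by field_simp
  rw [this, mul_pow]
  ring_nf

end rescale

section polarization

theorem pderiv_pderiv_comm {σ R : Type*} [CommRing R] (i j : σ) (P : MvPolynomial σ R) :
    pderiv i (pderiv j P) = pderiv j (pderiv i P) := by
  have h : ⁅(pderiv i : Derivation R (MvPolynomial σ R) (MvPolynomial σ R)),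
      (pderiv j : Derivation R (MvPolynomial σ R) (MvPolynomial σ R))⁆ = 0 := by
    refine MvPolynomial.derivation_ext fun k => ?_
    classical
    simp [Derivation.commutator_apply, pderiv_X, Pi.single_apply, apply_ite]
  rw [← sub_eq_zero, ← Derivation.commutator_apply, h, Derivation.zero_apply]

/-- The polar form of a quadratic form given by a polynomial. -/
theorem exists_polar {P : MvPolynomial (Fin 3) ℂ} (hP : P.IsHomogeneous 2) :
    ∃ B : LinearMap.BilinForm ℂ (Fin 3 → ℂ), B.IsSymm ∧ (∀ v, B v v = 2 * eval v P) ∧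
      ∀ v w, B v w = ∑ i, gradP P v i * w i := by
  have h1 : ∀ i, (pderiv i P).IsHomogeneous 1 := fun i => hP.pderiv
  have h2 : ∀ i j, pderiv j (pderiv i P) = C (coeff 0 (pderiv j (pderiv i P))) := fun i j =>
    (totalDegree_eq_zero_iff_eq_C (p := pderiv j (pderiv i P))).1
      ((totalDegree_zero_iff_isHomogeneous _).2 (h1 i).pderiv)
  set c : Matrix (Fin 3) (Fin 3) ℂ := fun i j => coeff 0 (pderiv j (pderiv i P)) with hc
  have hgrad : ∀ v i, gradP P v i = ∑ j, v j * c i j := fun v i => by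
    have := congrArg (eval v) (h1 i).sum_X_mul_pderiv
    rw [one_smul, map_sum] at this
    rw [gradP, ← this]
    refine Finset.sum_congr rfl fun j _ => ?_
    rw [map_mul, eval_X, h2, eval_C]
  have hsum : ∀ v w, Matrix.toBilin' c v w = ∑ i, gradP P w i * v i := fun v w => by
    rw [Matrix.toBilin'_apply]
    refine Finset.sum_congr rfl fun i _ => ?_
    rw [hgrad, Finset.sum_mul]
    exact Finset.sum_congr rfl fun j _ => by ring
  have hsymm : (Matrix.toBilin' c).IsSymm := by
    refine ⟨fun v w => ?_⟩
    rw [Matrix.toBilin'_apply, Matrix.toBilin'_apply, Finset.sum_comm]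
    refine Finset.sum_congr rfl fun i _ => Finset.sum_congr rfl fun j _ => ?_
    rw [hc]
    simp only
    rw [pderiv_pderiv_comm]
    ring
  refine ⟨_, hsymm, fun v => ?_, fun v w => by rw [← hsum]; exact hsymm.eq v w⟩
  rw [hsum]
  have := congrArg (eval v) hP.sum_X_mul_pderiv
  rw [map_sum, map_nsmul, nsmul_eq_mul] at this
  simpa [gradP, mul_comm] using this

/-- A smooth conic is the zero locus of a nondegenerate symmetric bilinear form. -/
theorem IsSmoothConic.exists_bilinForm {Q : Set P2} (hQ : IsSmoothConic Q) :
    ∃ B : LinearMap.BilinForm ℂ (Fin 3 → ℂ), B.IsSymm ∧ (∀ v, (∀ w, B v w = 0) → v = 0) ∧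
      ∀ v hv, Projectivization.mk ℂ v hv ∈ Q ↔ B v v = 0 := by
  obtain ⟨P, hP, hgrad, rfl⟩ := hQ
  obtain ⟨B, hB, hBP, hBg⟩ := exists_polar hP
  refine ⟨B, hB, fun v hv => ?_, fun v hv => ?_⟩
  · by_contra h0
    refine hgrad v h0 (funext fun i => ?_)
    have := hv (Pi.single i 1)
    rw [hBg] at this
    simpa [Pi.single_apply] using this
  · obtain ⟨a, ha⟩ := Projectivization.exists_smul_eq_mk_rep ℂ v hv
    have := hBP (a • v)
    rw [zeroLocusP2, mem_ofPred_eq, ← ha]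
    rw [Units.smul_def] at this ⊢
    simp only [map_smul, LinearMap.smul_apply, smul_eq_mul] at this
    constructor
    · intro h
      rw [h, mul_zero] at this
      simpa using this
    · intro h
      rw [h] at this
      simpa using this

/-- Normal form of a nondegenerate ternary quadratic form at an isotropic vector. -/
theorem exists_frame (B : LinearMap.BilinForm ℂ (Fin 3 → ℂ)) (hB : B.IsSymm)
    (hnd : ∀ v, (∀ w, B v w = 0) → v = 0) {u : Fin 3 → ℂ} (hu : u ≠ 0) (huu : B u u = 0) :
    ∃ g : (Fin 3 → ℂ) ≃L[ℂ] (Fin 3 → ℂ), g ![0, 1, 0] = u ∧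
      ∀ v, B (g v) (g v) = 2 * (v 0 ^ 2 - v 1 * v 2) := by
  have hs : ∀ v w, B v w = B w v := fun v w => hB.eq v w
  obtain ⟨w, hw⟩ : ∃ w, B u w = -1 := by
    by_contra! h
    refine hu (hnd u fun w => ?_)
    by_contra h0
    exact h (-(B u w)⁻¹ • w) (by simp [h0])
  obtain ⟨w', hw', hww⟩ : ∃ w', B u w' = -1 ∧ B w' w' = 0 :=
    ⟨w + (B w w / 2) • u, by simp [hw, huu], by
      simp only [map_add, map_smul, LinearMap.add_apply, LinearMap.smul_apply, smul_eq_mul, huu,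
        hs w u, hw]
      ring⟩
  obtain ⟨m, hm0, hm⟩ : ∃ m : Fin 3 → ℂ, m ≠ 0 ∧ (B u).prod (B w') m = 0 := by
    have h := LinearMap.ker_ne_bot_of_finrank_lt (f := (B u).prod (B w')) (by simp)
    obtain ⟨m, hm, hm0⟩ := (Submodule.ne_bot_iff _).1 h
    exact ⟨m, hm0, hm⟩
  obtain ⟨hum, hwm⟩ : B u m = 0 ∧ B w' m = 0 := by simpa using hm
  have happ : ∀ m v : Fin 3 → ℂ, Fintype.linearCombination ℂ ![m, u, w'] v =
      v 0 • m + v 1 • u + v 2 • w' := fun m v => by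
    simp [Fintype.linearCombination_apply, Fin.sum_univ_three]
  have hinj : ∀ m, m ≠ 0 → B u m = 0 → B w' m = 0 →
      Function.Injective (Fintype.linearCombination ℂ ![m, u, w']) := fun m hm0 hum hwm => by
    refine (injective_iff_map_eq_zero _).2 fun v hv => ?_
    rw [happ] at hv
    have h1 := congrArg (B u) hv
    have h2 := congrArg (B w') hv
    simp [hum, huu, hw', hwm, hww, hs w' u] at h1 h2
    simp [hm0, h1, h2] at hv
    ext i
    fin_cases i <;> assumption
  have hmm : B m m ≠ 0 := fun hmm => hm0 (hnd m fun w => by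
    obtain ⟨v, rfl⟩ := LinearMap.surjective_of_injective (hinj m hm0 hum hwm) w
    rw [happ]
    simp [hmm, hs m, hum, hwm])
  obtain ⟨d, hd⟩ := IsAlgClosed.exists_pow_nat_eq (2 / B m m) two_pos
  have hd0 : d ≠ 0 := by
    rintro rfl
    rw [zero_pow two_ne_zero, eq_comm, div_eq_zero_iff] at hd
    exact hd.elim two_ne_zero hmm
  refine ⟨(LinearEquiv.ofInjectiveEndo _ (hinj (d • m) (smul_ne_zero hd0 hm0) (by simp [hum])
    (by simp [hwm]))).toContinuousLinearEquiv, ?_, fun v => ?_⟩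
  · change Fintype.linearCombination ℂ ![d • m, u, w'] _ = _
    rw [happ]
    simp
  · change B (Fintype.linearCombination ℂ ![d • m, u, w'] _)
      (Fintype.linearCombination ℂ ![d • m, u, w'] _) = _
    rw [happ]
    simp only [map_add, map_smul, LinearMap.add_apply, LinearMap.smul_apply, smul_eq_mul, huu,
      hs m, hs w' u, hum, hwm, hw', hww]
    have : d ^ 2 * B m m = 2 := by
      rw [hd]
      field_simp
    linear_combination v 0 ^ 2 * this

end polarization

section reduction

/-- A polynomial function of degree at most three without zeros is constant. -/
theorem coeff_eq_zero_of_cubic_ne_zero {a b c d : ℂ}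
    (h : ∀ s : ℂ, a * s ^ 3 + b * s ^ 2 + c * s + d ≠ 0) : a = 0 ∧ b = 0 ∧ c = 0 := by
  have hdeg : (Cubic.toPoly ⟨a, b, c, d⟩).degree = 0 := by
    by_contra h0
    obtain ⟨s, hs⟩ := IsAlgClosed.exists_root _ h0
    refine h s ?_
    simpa [Cubic.toPoly] using hs
  have hk : ∀ k : ℕ, 0 < k → (Cubic.toPoly ⟨a, b, c, d⟩).coeff k = 0 := fun k hk =>
    Polynomial.coeff_eq_zero_of_degree_lt (by rw [hdeg]; exact_mod_cast hk)
  exact ⟨by simpa using hk 3 (by norm_num), by simpa using hk 2 (by norm_num),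
    by simpa using hk 1 (by norm_num)⟩

theorem exists_isotropic (B : LinearMap.BilinForm ℂ (Fin 3 → ℂ)) :
    ∃ u : Fin 3 → ℂ, u ≠ 0 ∧ B u u = 0 := by
  by_cases h0 : B ![1, 0, 0] ![1, 0, 0] = 0
  · exact ⟨_, by simp, h0⟩
  · obtain ⟨x, hx⟩ := exists_quadratic_eq_zero
      (b := B ![1, 0, 0] ![0, 1, 0] + B ![0, 1, 0] ![1, 0, 0]) (c := B ![0, 1, 0] ![0, 1, 0]) h0
      (IsAlgClosed.exists_eq_mul_self _)
    refine ⟨x • ![1, 0, 0] + ![0, 1, 0], fun h => by simpa using congrFun h 1, ?_⟩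
    simp only [map_add, map_smul, LinearMap.add_apply, LinearMap.smul_apply, smul_eq_mul]
    linear_combination hx

theorem apply_self_eq_sum {B : LinearMap.BilinForm ℂ (Fin 3 → ℂ)} (hB : B.IsSymm)
    (v : Fin 3 → ℂ) :
    B v v = v 0 ^ 2 * B ![1, 0, 0] ![1, 0, 0] + v 1 ^ 2 * B ![0, 1, 0] ![0, 1, 0] +
      v 2 ^ 2 * B ![0, 0, 1] ![0, 0, 1] + 2 * v 0 * v 1 * B ![1, 0, 0] ![0, 1, 0] +
      2 * v 0 * v 2 * B ![1, 0, 0] ![0, 0, 1] + 2 * v 1 * v 2 * B ![0, 1, 0] ![0, 0, 1] := by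
  have hs : ∀ v w, B v w = B w v := fun v w => hB.eq v w
  have hv : v = v 0 • ![1, 0, 0] + v 1 • ![0, 1, 0] + v 2 • ![0, 0, 1] := by
    ext i
    fin_cases i <;> simp
  conv_lhs => rw [hv]
  simp only [map_add, map_smul, LinearMap.add_apply, LinearMap.smul_apply, smul_eq_mul]
  rw [hs ![0, 1, 0] ![1, 0, 0], hs ![0, 0, 1] ![1, 0, 0], hs ![0, 0, 1] ![0, 1, 0]]
  ring

/-- A nondegenerate form meeting the conic `v₀² = v₁v₂` only at `[0 : 1 : 0]` lies in the pencil
spanned by this conic and the doubled tangent line. -/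
theorem exists_pencil_of_isotropic {B : LinearMap.BilinForm ℂ (Fin 3 → ℂ)} (hB : B.IsSymm)
    (hnd : ∀ v, (∀ w, B v w = 0) → v = 0) (h1 : B ![0, 1, 0] ![0, 1, 0] = 0)
    (h2 : ∀ s : ℂ, B ![s, s ^ 2, 1] ![s, s ^ 2, 1] ≠ 0) :
    ∃ a t : ℂ, a ≠ 0 ∧ ∀ v, B v v = a * (v 0 ^ 2 - v 1 * v 2 - t * v 2 ^ 2) := by
  have hs : ∀ v w, B v w = B w v := fun v w => hB.eq v w
  obtain ⟨h01, h12, h02⟩ := coeff_eq_zero_of_cubic_ne_zero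
    (a := 2 * B ![1, 0, 0] ![0, 1, 0])
    (b := B ![1, 0, 0] ![1, 0, 0] + 2 * B ![0, 1, 0] ![0, 0, 1])
    (c := 2 * B ![1, 0, 0] ![0, 0, 1]) (d := B ![0, 0, 1] ![0, 0, 1]) fun s => by
      have := h2 s
      rw [apply_self_eq_sum hB, h1] at this
      simp only [Matrix.cons_val_zero, Matrix.cons_val_one, Matrix.cons_val] at this
      convert this using 1
      ring
  have h00 : B ![1, 0, 0] ![1, 0, 0] ≠ 0 := by
    intro h00
    have h := hnd ![1, 0, 0] fun w => by
      have hw : w = w 0 • ![1, 0, 0] + w 1 • ![0, 1, 0] + w 2 • ![0, 0, 1] := by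
        ext i
        fin_cases i <;> simp
      rw [hw]
      simp only [map_add, map_smul, smul_eq_mul, h00]
      linear_combination w 1 / 2 * h01 + w 2 / 2 * h02
    simpa using congrFun h 0
  refine ⟨B ![1, 0, 0] ![1, 0, 0], -B ![0, 0, 1] ![0, 0, 1] / B ![1, 0, 0] ![1, 0, 0], h00,
    fun v => ?_⟩
  rw [apply_self_eq_sum hB]
  field_simp
  linear_combination v 0 * v 1 * h01 + v 1 * v 2 * h12 + v 0 * v 2 * h02 + v 1 ^ 2 * h1

/-- Conics meeting pairwise in one common point belong to a hyperosculating pencil. -/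
theorem exists_pencil {n : ℕ} (hn : 1 ≤ n) {Q : Fin n → Set P2}
    (hconic : ∀ i, IsSmoothConic (Q i)) {p : P2} (hint : ∀ i j : Fin n, i ≠ j → Q i ∩ Q j = {p}) :
    ∃ (g : (Fin 3 → ℂ) ≃L[ℂ] (Fin 3 → ℂ)) (T : Fin n → ℂ), ∀ k v, frameMk g v ∈ Q k ↔
      v.1 0 ^ 2 - v.1 1 * v.1 2 = T k * v.1 2 ^ 2 := by
  choose B hB hnd hBQ using fun i => (hconic i).exists_bilinForm
  let o : Fin n := ⟨0, hn⟩
  obtain ⟨u, hu, huu, hup⟩ : ∃ u : Fin 3 → ℂ, ∃ hu : u ≠ 0, B o u u = 0 ∧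
      ∀ j, j ≠ o → Q o ∩ Q j = {Projectivization.mk ℂ u hu} := by
    by_cases h : ∃ j, j ≠ o
    · obtain ⟨j, hj⟩ := h
      have hp : p ∈ Q o ∩ Q j := by rw [hint _ _ hj.symm]; rfl
      refine ⟨p.rep, p.rep_nonzero, (hBQ o _ p.rep_nonzero).1 ?_, fun j hj => ?_⟩
      · rw [p.mk_rep]
        exact hp.1
      · rw [p.mk_rep, hint _ _ hj.symm]
    · push Not at h
      obtain ⟨u, hu, huu⟩ := exists_isotropic (B o)
      exact ⟨u, hu, huu, fun j hj => absurd (h j) hj⟩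
  obtain ⟨g, hg, hgB⟩ := exists_frame (B o) (hB o) (hnd o) hu huu
  have hmem : ∀ k v, frameMk g v ∈ Q k ↔ B k (g v) (g v) = 0 := fun k v => hBQ k _ _
  suffices h : ∀ k, ∃ a t : ℂ, a ≠ 0 ∧
      ∀ v, B k (g v) (g v) = a * (v 0 ^ 2 - v 1 * v 2 - t * v 2 ^ 2) by
    choose a T ha hT using h
    refine ⟨g, T, fun k v => ?_⟩
    rw [hmem, hT, mul_eq_zero, or_iff_right (ha k), sub_eq_zero]
  intro k
  by_cases hk : k = o
  · subst hk
    exact ⟨2, 0, two_ne_zero, fun v => by rw [hgB]; ring⟩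
  set e : (Fin 3 → ℂ) →ₗ[ℂ] (Fin 3 → ℂ) := g.toLinearEquiv.toLinearMap with he
  refine exists_pencil_of_isotropic (B := (B k).compl₁₂ e e)
    ⟨fun v w => (hB k).eq _ _⟩ (fun v hv => ?_) ?_ fun s hs => ?_
  · have := hnd k (g v) fun w => by simpa [he] using hv (g.symm w)
    simpa using this
  · change B k (g _) (g _) = 0
    rw [hg, ← hBQ k u hu]
    have : Projectivization.mk ℂ u hu ∈ Q o ∩ Q k := by rw [hup k hk]; rfl
    exact this.2
  · have hv0 : (![s, s ^ 2, 1] : Fin 3 → ℂ) ≠ 0 := fun h => by simpa using congrFun h 2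
    have hv1 : (![0, 1, 0] : Fin 3 → ℂ) ≠ 0 := fun h => by simpa using congrFun h 1
    have h : frameMk g ⟨_, hv0⟩ ∈ Q o ∩ Q k := by
      refine ⟨(hmem _ _).2 ?_, (hmem _ _).2 hs⟩
      rw [hgB]
      simp
    have hu' : Projectivization.mk ℂ u hu = frameMk g ⟨_, hv1⟩ := by
      simp only [frameMk, hg]
    rw [hup k hk, mem_singleton_iff, hu', frameMk_eq_iff] at h
    obtain ⟨a, ha⟩ := h
    simpa using congrFun ha 2

end reduction

end

/-- **Theorem (arrangement ℬₙ).** If `Q₁, …, Qₙ` are pairwise distinct smooth conics, any two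
of which meet set-theoretically in exactly one common point `p` (so any two of them are tangent
at `p` with contact of order four), then `π₁(ℙ² ∖ (Q₁ ∪ ⋯ ∪ Qₙ))` is presented by
`⟨a₁, …, aₙ | (a₁a₂⋯aₙ)² = e⟩`. -/
theorem fundamental_group_Bn (n : ℕ) (hn : 1 ≤ n) (Q : Fin n → Set P2)
    (hconic : ∀ i, IsSmoothConic (Q i))
    (hdist : ∀ i j : Fin n, i ≠ j → Q i ≠ Q j)
    (p : P2)
    (hint : ∀ i j : Fin n, i ≠ j → Q i ∩ Q j = {p})
    (x : ↥(⋃ i, Q i)ᶜ) :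
    Nonempty (FundamentalGroup (↥(⋃ i, Q i)ᶜ) x ≃* PresentedGroup (relAn n)) := by
  obtain ⟨g, T, hgT⟩ := exists_pencil hn hconic hint
  refine nonempty_mulEquiv_of_injective (T := T) (g := g) hn (fun i j hij => ?_) (fun v => ?_) x
  · by_contra h
    refine hdist i j h (Set.ext fun y => ?_)
    obtain ⟨v, rfl⟩ := frameMk_surjective g y
    rw [hgT, hgT, hij]
  · simp [hgT]
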